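/- arXiv:2605.02193 — 5 statements merged into one kernel-verified Lean document; each statement's English description precedes it below -/
import Mathlib

section
/- Let G be a finite simple graph on vertex set {1,…,n}. Then the continuous dominating-set quantities are log-concave: for every real number k with 1 ≤ k ≤ n−1, one has 𝑑̃_k(G)^2 ≥ 𝑑̃_{k−1}(G) · 𝑑̃_{k+1}(G). -/
open MeasureTheory

/-- The polytope `P(G) = { x ∈ [0,1]^n : x_i + Σ_{j : {i,j} ∈ E} x_j ≥ 1 for all i }`,
viewed inside Euclidean space so that `(n-1)`-dimensional volume makes sense. -/
def graphPolytope {n : ℕ} (G : SimpleGraph (Fin n)) [DecidableRel G.Adj] :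
    Set (EuclideanSpace ℝ (Fin n)) :=
  {x | (∀ i, 0 ≤ x i ∧ x i ≤ 1) ∧ ∀ i, 1 ≤ x i + ∑ j ∈ G.neighborFinset i, x j}

/-- The slice `D_k(G) = { x ∈ P(G) : Σ_v x_v = k }`. -/
def domSlice {n : ℕ} (G : SimpleGraph (Fin n)) [DecidableRel G.Adj] (k : ℝ) :
    Set (EuclideanSpace ℝ (Fin n)) :=
  {x ∈ graphPolytope G | ∑ i, x i = k}

/-- `d̃_k(G)`: the `(n-1)`-dimensional volume (Hausdorff measure) of the slice `D_k(G)`. -/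
noncomputable def dTilde {n : ℕ} (G : SimpleGraph (Fin n)) [DecidableRel G.Adj]
    (k : ℝ) : ENNReal :=
  MeasureTheory.Measure.hausdorffMeasure ((n : ℝ) - 1) (domSlice G k)

/-- Brunn–Minkowski on the line: the measure of a sumset dominates the sum of the measures. -/
theorem volume_add_volume_le_of_add_mem {A B C : Set ℝ} (hA : MeasurableSet A)
    (hB : MeasurableSet B) (hAne : A.Nonempty) (hBne : B.Nonempty)
    (h : ∀ a ∈ A, ∀ b ∈ B, a + b ∈ C) : volume A + volume B ≤ volume C := by
  have key : ∀ K ⊆ A, IsCompact K → K.Nonempty → ∀ L ⊆ B, IsCompact L → L.Nonempty →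
      volume K + volume L ≤ volume C := by
    intro K hKA hK hKne L hLB hL hLne
    obtain ⟨a, haK, ha⟩ := hK.exists_isGreatest hKne
    obtain ⟨b, hbL, hb⟩ := hL.exists_isLeast hLne
    have hsub : ((fun x => x + (-b)) ⁻¹' K) ∪ ((fun x => -a + x) ⁻¹' L) ⊆ C := by
      rintro z (hz | hz)
      · simpa using h _ (hKA hz) _ (hLB hbL)
      · simpa using h _ (hKA haK) _ (hLB hz)
    have hinter : ((fun x => x + (-b)) ⁻¹' K) ∩ ((fun x => -a + x) ⁻¹' L) ⊆ {a + b} := by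
      rintro z ⟨hz₁, hz₂⟩
      have h₁ : z + -b ≤ a := ha hz₁
      have h₂ : b ≤ -a + z := hb hz₂
      rw [Set.mem_singleton_iff]
      linarith
    have hzero : volume (((fun x => x + (-b)) ⁻¹' K) ∩ ((fun x => -a + x) ⁻¹' L)) = 0 :=
      measure_mono_null hinter Real.volume_singleton
    have hmeas : MeasurableSet ((fun x => -a + x) ⁻¹' L) :=
      hL.measurableSet.preimage (measurable_const_add _)
    have := measure_union_add_inter (μ := volume) ((fun x => x + (-b)) ⁻¹' K) hmeas
    rw [hzero, add_zero, measure_preimage_add_right, measure_preimage_add] at this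
    rw [← this]
    exact measure_mono hsub
  have key' : ∀ K ⊆ A, IsCompact K → ∀ L ⊆ B, IsCompact L →
      volume K + volume L ≤ volume C := by
    intro K hKA hK L hLB hL
    obtain ⟨a, ha⟩ := hAne
    obtain ⟨b, hb⟩ := hBne
    refine le_trans (add_le_add (measure_mono (Set.subset_insert a K))
      (measure_mono (Set.subset_insert b L))) ?_
    exact key _ (Set.insert_subset ha hKA) (hK.insert a) (Set.insert_nonempty _ _)
      _ (Set.insert_subset hb hLB) (hL.insert b) (Set.insert_nonempty _ _)
  have hsup : ∀ S : Set ℝ, MeasurableSet S →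
      volume S = ⨆ K : {K : Set ℝ // K ⊆ S ∧ IsCompact K}, volume K.1 := fun S hS => by
    rw [hS.measure_eq_iSup_isCompact, iSup_subtype]
    simp only [iSup_and]
  have : Nonempty {K : Set ℝ // K ⊆ A ∧ IsCompact K} := ⟨∅, Set.empty_subset _, isCompact_empty⟩
  have : Nonempty {K : Set ℝ // K ⊆ B ∧ IsCompact K} := ⟨∅, Set.empty_subset _, isCompact_empty⟩
  rw [hsup A hA, hsup B hB]
  exact ENNReal.iSup_add_iSup_le fun K L => key' _ K.2.1 K.2.2 _ L.2.1 L.2.2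

/-- The additive Prékopa–Leindler inequality on the line for functions with supremum one. -/
theorem lintegral_add_lintegral_le_of_iSup_eq_one {f g h : ℝ → ℝ} (hf : Measurable f)
    (hg : Measurable g) (hh : Measurable h) (hf0 : 0 ≤ f) (hg0 : 0 ≤ g) (hh0 : 0 ≤ h)
    (hf1 : f ≤ 1) (hg1 : g ≤ 1) (hfs : ∀ s < 1, ∃ x, s < f x) (hgs : ∀ s < 1, ∃ x, s < g x)
    (hfg : ∀ x y, f x * g y ≤ h (2⁻¹ * (x + y)) ^ 2) :
    (∫⁻ x, ENNReal.ofReal (f x)) + ∫⁻ x, ENNReal.ofReal (g x) ≤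
      2 * ∫⁻ x, ENNReal.ofReal (h x) := by
  rw [lintegral_eq_lintegral_meas_lt volume (.of_forall hf0) hf.aemeasurable,
    lintegral_eq_lintegral_meas_lt volume (.of_forall hg0) hg.aemeasurable,
    lintegral_eq_lintegral_meas_lt volume (.of_forall hh0) hh.aemeasurable,
    ← lintegral_const_mul' _ _ ENNReal.ofNat_ne_top]
  refine (le_lintegral_add _ _).trans (setLIntegral_mono' measurableSet_Ioi fun t ht => ?_)
  rw [Set.mem_Ioi] at ht
  rcases le_or_gt 1 t with ht1 | ht1
  · have e₁ : {a | t < f a} = ∅ :=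
      Set.eq_empty_of_forall_notMem fun a ha => (lt_of_le_of_lt ht1 ha).not_ge (hf1 a)
    have e₂ : {a | t < g a} = ∅ :=
      Set.eq_empty_of_forall_notMem fun a ha => (lt_of_le_of_lt ht1 ha).not_ge (hg1 a)
    simp [e₁, e₂]
  · have hpre : volume ((fun x : ℝ => 2⁻¹ * x) ⁻¹' {a | t < h a}) = 2 * volume {a | t < h a} := by
      rw [Real.volume_preimage_mul_left (by norm_num)]
      norm_num
    rw [← hpre]
    refine volume_add_volume_le_of_add_mem (measurableSet_lt measurable_const hf)
      (measurableSet_lt measurable_const hg) (hfs t ht1) (hgs t ht1) fun a ha b hb => ?_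
    have ha' : t < f a := ha
    have hb' : t < g b := hb
    have := hfg a b
    change t < h (2⁻¹ * (a + b))
    refine lt_of_pow_lt_pow_left₀ 2 (hh0 _) (lt_of_lt_of_le ?_ this)
    nlinarith

theorem ENNReal.mul_le_sq_of_add_le_two_mul {x y z : ENNReal} (h : x + y ≤ 2 * z) :
    x * y ≤ z ^ 2 := by
  rcases eq_or_ne z ⊤ with rfl | hz
  · simp
  have hxy : x + y ≠ ⊤ := ne_top_of_le_ne_top (ENNReal.mul_ne_top (by simp) hz) h
  obtain ⟨hx, hy⟩ := ENNReal.add_ne_top.1 hxy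
  lift x to NNReal using hx
  lift y to NNReal using hy
  lift z to NNReal using hz
  norm_cast at h ⊢
  have h' : (x : ℝ) + y ≤ 2 * z := by exact_mod_cast h
  have : (x : ℝ) * y ≤ z ^ 2 := by
    nlinarith [sq_nonneg ((x : ℝ) - y), x.2, y.2, z.2, add_nonneg x.2 y.2]
  exact_mod_cast this

/-- The Prékopa–Leindler inequality on the line, for functions with finite supremum. -/
theorem prekopaLeindler_real_of_iSup_ne_top {f g h : ℝ → ENNReal} (hf : Measurable f)
    (hg : Measurable g) (hh : Measurable h) (hfM : ⨆ x, f x ≠ ⊤) (hgM : ⨆ x, g x ≠ ⊤)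
    (hfg : ∀ x y, f x * g y ≤ h (2⁻¹ * (x + y)) ^ 2) :
    (∫⁻ x, f x) * ∫⁻ x, g x ≤ (∫⁻ x, h x) ^ 2 := by
  set M := ⨆ x, f x with hM
  set N := ⨆ x, g x with hN
  rcases eq_or_ne M 0 with hM0 | hM0
  · have : ∀ x, f x = 0 := fun x => le_bot_iff.1 ((le_iSup f x).trans_eq hM0)
    simp [this]
  rcases eq_or_ne N 0 with hN0 | hN0
  · have : ∀ x, g x = 0 := fun x => le_bot_iff.1 ((le_iSup g x).trans_eq hN0)
    simp [this]
  obtain ⟨R, hR⟩ : ∃ R : ENNReal, R ^ 2 = M⁻¹ * N⁻¹ :=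
    ⟨(M⁻¹ * N⁻¹) ^ (2⁻¹ : ℝ), by rw [← ENNReal.rpow_natCast, ← ENNReal.rpow_mul]; simp⟩
  have hMN0 : M⁻¹ * N⁻¹ ≠ 0 := mul_ne_zero (by simpa using hfM) (by simpa using hgM)
  have hMNt : M⁻¹ * N⁻¹ ≠ ⊤ := ENNReal.mul_ne_top (by simpa using hM0) (by simpa using hN0)
  have hsup : ∀ (F : ℝ → ENNReal) (K : ENNReal), K = ⨆ x, F x → K ≠ 0 → K ≠ ⊤ →
      (∀ x, K⁻¹ * F x ≤ 1) ∧ ∀ s < (1 : ℝ), ∃ x, s < (K⁻¹ * F x).toReal := by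
    intro F K hK hK0 hKt
    have hle : ∀ x, K⁻¹ * F x ≤ 1 := fun x => by
      rw [← ENNReal.inv_mul_cancel hK0 hKt]
      gcongr
      exact hK ▸ le_iSup F x
    refine ⟨hle, fun s hs => ?_⟩
    have h1 : ENNReal.ofReal s < ⨆ x, K⁻¹ * F x := by
      rw [← ENNReal.mul_iSup, ← hK, ENNReal.inv_mul_cancel hK0 hKt]
      simpa using hs
    obtain ⟨x, hx⟩ := lt_iSup_iff.1 h1
    refine ⟨x, ?_⟩
    by_contra! hsx
    exact hx.not_ge ((ENNReal.le_ofReal_iff_toReal_le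
      (ne_top_of_le_ne_top (by simp) (hle x)) (ENNReal.toReal_nonneg.trans hsx)).2 hsx)
  obtain ⟨hf1, hfs⟩ := hsup f M hM hM0 hfM
  obtain ⟨hg1, hgs⟩ := hsup g N hN hN0 hgM
  have hft : ∀ x, M⁻¹ * f x ≠ ⊤ := fun x => ne_top_of_le_ne_top (by simp) (hf1 x)
  have hgt : ∀ x, N⁻¹ * g x ≠ ⊤ := fun x => ne_top_of_le_ne_top (by simp) (hg1 x)
  have hht : ∀ x, min (R * h x) 1 ≠ ⊤ := fun x => ne_top_of_le_ne_top (by simp) (min_le_right _ _)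
  have main := lintegral_add_lintegral_le_of_iSup_eq_one
    (f := fun x => (M⁻¹ * f x).toReal) (g := fun x => (N⁻¹ * g x).toReal)
    (h := fun x => (min (R * h x) 1).toReal) (by fun_prop) (by fun_prop) (by fun_prop)
    (fun _ => ENNReal.toReal_nonneg) (fun _ => ENNReal.toReal_nonneg)
    (fun _ => ENNReal.toReal_nonneg) (fun x => ENNReal.toReal_le_of_le_ofReal (by simp)
      (by simpa using hf1 x))
    (fun x => ENNReal.toReal_le_of_le_ofReal (by simp) (by simpa using hg1 x)) hfs hgs
    (fun x y => by
      rw [← ENNReal.toReal_mul, ← ENNReal.toReal_pow]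
      refine ENNReal.toReal_mono (ENNReal.pow_ne_top (hht _)) ?_
      rcases min_choice (R * h (2⁻¹ * (x + y))) 1 with hc | hc <;> rw [hc]
      · calc M⁻¹ * f x * (N⁻¹ * g y) = (M⁻¹ * N⁻¹) * (f x * g y) := by ring
          _ ≤ R ^ 2 * h (2⁻¹ * (x + y)) ^ 2 := by rw [hR]; gcongr; exact hfg x y
          _ = _ := by ring
      · simpa using mul_le_mul' (hf1 x) (hg1 y))
  simp only [ENNReal.ofReal_toReal (hft _), ENNReal.ofReal_toReal (hgt _),
    ENNReal.ofReal_toReal (hht _)] at main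
  have main' : M⁻¹ * (∫⁻ x, f x) + N⁻¹ * ∫⁻ x, g x ≤ 2 * (R * ∫⁻ x, h x) := by
    rw [← lintegral_const_mul _ hf, ← lintegral_const_mul _ hg, ← lintegral_const_mul _ hh]
    refine main.trans ?_
    gcongr
    exact min_le_left _ _
  have := ENNReal.mul_le_sq_of_add_le_two_mul main'
  rw [mul_pow, hR, mul_mul_mul_comm] at this
  exact (ENNReal.mul_le_mul_iff_right hMN0 hMNt).1 this

/-- The Prékopa–Leindler inequality on the line. -/
theorem prekopaLeindler_real {f g h : ℝ → ENNReal} (hf : Measurable f)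
    (hg : Measurable g) (hh : Measurable h)
    (hfg : ∀ x y, f x * g y ≤ h (2⁻¹ * (x + y)) ^ 2) :
    (∫⁻ x, f x) * ∫⁻ x, g x ≤ (∫⁻ x, h x) ^ 2 := by
  have htrunc : ∀ F : ℝ → ENNReal, Measurable F →
      ∫⁻ x, F x = ⨆ m : ℕ, ∫⁻ x, min (F x) m := by
    intro F hF
    rw [← lintegral_iSup (f := fun (m : ℕ) x => min (F x) m) (fun m => by fun_prop)
      (fun m m' hm x => min_le_min le_rfl (by exact_mod_cast hm))]
    congr 1 with x
    rw [← inf_iSup_eq, ENNReal.iSup_natCast, inf_top_eq]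
  have hbdd : ∀ (F : ℝ → ENNReal) (m : ℕ), ⨆ x, min (F x) m ≠ ⊤ := fun F m =>
    ne_top_of_le_ne_top (ENNReal.natCast_ne_top m) (iSup_le fun x => min_le_right _ _)
  rw [htrunc f hf, htrunc g hg, ENNReal.iSup_mul]
  refine iSup_le fun m => ?_
  rw [ENNReal.mul_iSup]
  refine iSup_le fun m' => prekopaLeindler_real_of_iSup_ne_top (by fun_prop) (by fun_prop) hh
    (hbdd f m) (hbdd g m') fun x y => le_trans ?_ (hfg x y)
  exact mul_le_mul' (min_le_left _ _) (min_le_left _ _)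

/-- The Prékopa–Leindler inequality on `ℝⁿ`, with weights `1/2`. -/
theorem prekopaLeindler_pi {N : ℕ} {f g h : (Fin N → ℝ) → ENNReal} (hf : Measurable f)
    (hg : Measurable g) (hh : Measurable h)
    (hfg : ∀ x y, f x * g y ≤ h ((2⁻¹ : ℝ) • (x + y)) ^ 2) :
    (∫⁻ x, f x) * ∫⁻ x, g x ≤ (∫⁻ x, h x) ^ 2 := by
  induction N with
  | zero =>
    simp only [lintegral_unique, volume_pi, Measure.pi_empty_univ, mul_one]
    convert hfg default default
  | succ N ih =>
    let e := (MeasurableEquiv.piFinSuccAbove (fun _ : Fin (N + 1) => ℝ) 0).symm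
    have he : MeasurePreserving e :=
      (volume_preserving_piFinSuccAbove (fun _ : Fin (N + 1) => ℝ) 0).symm
    have hsplit : ∀ F : (Fin (N + 1) → ℝ) → ENNReal, Measurable F →
        ∫⁻ x, F x = ∫⁻ t, ∫⁻ y, F (e (t, y)) := fun F hF => by
      rw [← he.lintegral_comp hF]
      exact lintegral_prod _ (hF.comp e.measurable).aemeasurable
    have hadd : ∀ s t x y, e (2⁻¹ * (s + t), (2⁻¹ : ℝ) • (x + y)) =
        (2⁻¹ : ℝ) • (e (s, x) + e (t, y)) := by
      intro s t x y
      ext i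
      refine Fin.cases ?_ (fun i => ?_) i <;>
        simp [e, MeasurableEquiv.piFinSuccAbove_symm_apply, Fin.insertNthEquiv, mul_add]
    have hslice : ∀ F : (Fin (N + 1) → ℝ) → ENNReal, Measurable F → ∀ t,
        Measurable fun y => F (e (t, y)) := fun F hF t =>
      hF.comp (e.measurable.comp measurable_prodMk_left)
    have hint : ∀ F : (Fin (N + 1) → ℝ) → ENNReal, Measurable F →
        Measurable fun t => ∫⁻ y, F (e (t, y)) := fun F hF =>
      (hF.comp e.measurable).lintegral_prod_right'
    rw [hsplit f hf, hsplit g hg, hsplit h hh]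
    refine prekopaLeindler_real (hint f hf) (hint g hg) (hint h hh) fun s t => ?_
    refine ih (hslice f hf s) (hslice g hg t) (hslice h hh _) fun x y => ?_
    rw [hadd]
    exact hfg _ _

/-- The multiplicative Brunn–Minkowski inequality for midpoints of sets. -/
theorem measure_mul_measure_le_sq_of_midpoint_mem {E : Type*} [NormedAddCommGroup E]
    [NormedSpace ℝ E] [FiniteDimensional ℝ E] [MeasurableSpace E] [BorelSpace E]
    (μ : Measure E) [μ.IsAddHaarMeasure] {A B C : Set E} (hA : MeasurableSet A)
    (hB : MeasurableSet B) (hC : MeasurableSet C)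
    (h : ∀ a ∈ A, ∀ b ∈ B, (2⁻¹ : ℝ) • (a + b) ∈ C) : μ A * μ B ≤ μ C ^ 2 := by
  let e : E ≃L[ℝ] (Fin (Module.finrank ℝ E) → ℝ) :=
    ContinuousLinearEquiv.ofFinrankEq (by simp)
  have hinv : (Measure.map e μ).IsAddHaarMeasure := e.isAddHaarMeasure_map μ
  obtain ⟨c, hc⟩ : ∃ c : NNReal, Measure.map e μ = c • volume :=
    ⟨_, Measure.isAddLeftInvariant_eq_smul _ _⟩
  have hvol : ∀ S : Set E, MeasurableSet S →
      MeasurableSet (e.symm ⁻¹' S) ∧ μ S = c * volume (e.symm ⁻¹' S) := fun S hS => by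
    have hS' : MeasurableSet (e.symm ⁻¹' S) := hS.preimage e.symm.continuous.measurable
    refine ⟨hS', ?_⟩
    have := congrArg (fun ν => ν (e.symm ⁻¹' S)) hc
    simp only [Measure.map_apply e.continuous.measurable hS'] at this
    rw [← Set.preimage_comp] at this
    simpa using this
  obtain ⟨hA', hAv⟩ := hvol A hA
  obtain ⟨hB', hBv⟩ := hvol B hB
  obtain ⟨hC', hCv⟩ := hvol C hC
  have := prekopaLeindler_pi (f := (e.symm ⁻¹' A).indicator 1) (g := (e.symm ⁻¹' B).indicator 1)
    (h := (e.symm ⁻¹' C).indicator 1) (measurable_one.indicator hA')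
    (measurable_one.indicator hB') (measurable_one.indicator hC') fun x y => by
      by_cases hx : x ∈ e.symm ⁻¹' A
      · by_cases hy : y ∈ e.symm ⁻¹' B
        · have hxy : (2⁻¹ : ℝ) • (x + y) ∈ e.symm ⁻¹' C := by
            simpa using h _ hx _ hy
          simp only [Set.indicator_of_mem hx, Set.indicator_of_mem hy, Set.indicator_of_mem hxy]
          simp
        · simp [Set.indicator_of_notMem hy]
      · simp [Set.indicator_of_notMem hx]
  rw [lintegral_indicator_one hA', lintegral_indicator_one hB', lintegral_indicator_one hC'] at this
  rw [hAv, hBv, hCv, mul_mul_mul_comm, mul_pow, ← sq]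
  gcongr

theorem isClosed_graphPolytope {n : ℕ} (G : SimpleGraph (Fin n)) [DecidableRel G.Adj] :
    IsClosed (graphPolytope G) := by
  simp only [graphPolytope, Set.ofPred_and, Set.ofPred_forall]
  refine IsClosed.inter (isClosed_iInter fun i => IsClosed.inter ?_ ?_)
    (isClosed_iInter fun i => ?_)
  all_goals exact isClosed_le (by fun_prop) (by fun_prop)

theorem midpoint_mem_graphPolytope {n : ℕ} (G : SimpleGraph (Fin n)) [DecidableRel G.Adj]
    {x y : EuclideanSpace ℝ (Fin n)} (hx : x ∈ graphPolytope G) (hy : y ∈ graphPolytope G) :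
    (2⁻¹ : ℝ) • (x + y) ∈ graphPolytope G := by
  refine ⟨fun i => ?_, fun i => ?_⟩
  · have h₁ := hx.1 i
    have h₂ := hy.1 i
    simp only [PiLp.smul_apply, PiLp.add_apply, smul_eq_mul]
    constructor <;> linarith
  · have h₁ := hx.2 i
    have h₂ := hy.2 i
    simp only [PiLp.smul_apply, PiLp.add_apply, smul_eq_mul, ← Finset.mul_sum,
      Finset.sum_add_distrib]
    linarith

/-- The all-ones vector, normal to the slicing hyperplanes. -/
noncomputable def allOnes (n : ℕ) : EuclideanSpace ℝ (Fin n) := WithLp.toLp 2 1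

theorem mem_orthogonal_allOnes {n : ℕ} {x : EuclideanSpace ℝ (Fin n)} :
    x ∈ (ℝ ∙ allOnes n)ᗮ ↔ ∑ i, x i = 0 := by
  rw [Submodule.mem_orthogonal_singleton_iff_inner_right]
  simp [allOnes, PiLp.inner_apply]

theorem dTilde_eq_hausdorffMeasure_preimage {N : ℕ} (G : SimpleGraph (Fin (N + 1)))
    [DecidableRel G.Adj] (k : ℝ) :
    dTilde G k = Measure.hausdorffMeasure (N : ℝ)
      {y : (ℝ ∙ allOnes (N + 1))ᗮ |
        (y : EuclideanSpace ℝ (Fin (N + 1))) + (k / (N + 1)) • allOnes (N + 1) ∈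
          graphPolytope G} := by
  set v := (k / (N + 1)) • allOnes (N + 1) with hv
  have hvsum : ∑ i, v i = k := by
    simp only [hv, allOnes, PiLp.smul_apply, Pi.one_apply, smul_eq_mul, mul_one,
      Finset.sum_const, Finset.card_univ, Fintype.card_fin, nsmul_eq_mul]
    push_cast
    field_simp
  have hiso : Isometry fun y : (ℝ ∙ allOnes (N + 1))ᗮ =>
      (y : EuclideanSpace ℝ (Fin (N + 1))) + v :=
    (isometry_add_right v).comp isometry_subtype_coe
  rw [← hiso.hausdorffMeasure_image (Or.inl (Nat.cast_nonneg N)), dTilde]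
  congr 1
  · congr 1
    push_cast
    ring
  · ext x
    constructor
    · rintro ⟨hx, hxk⟩
      refine ⟨⟨x - v, mem_orthogonal_allOnes.2 ?_⟩, ?_, ?_⟩
      · simp [Finset.sum_sub_distrib, hvsum, hxk]
      · simpa using hx
      · simp
    · rintro ⟨y, hy, rfl⟩
      refine ⟨hy, ?_⟩
      simp [Finset.sum_add_distrib, hvsum, mem_orthogonal_allOnes.1 y.2]

/-- The continuous dominating-set quantities `d̃_k(G)` are log-concave:
`d̃_k(G)^2 ≥ d̃_{k-1}(G) · d̃_{k+1}(G)` for every real `1 ≤ k ≤ n - 1`. -/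
theorem dTilde_log_concave {n : ℕ} (G : SimpleGraph (Fin n)) [DecidableRel G.Adj]
    (k : ℝ) (hk1 : 1 ≤ k) (hk2 : k ≤ (n : ℝ) - 1) :
    dTilde G (k - 1) * dTilde G (k + 1) ≤ dTilde G k ^ 2 := by
  obtain _ | N := n
  · norm_num at hk2
    linarith
  have hfact : Fact (Module.finrank ℝ (EuclideanSpace ℝ (Fin (N + 1))) = N + 1) :=
    ⟨finrank_euclideanSpace_fin⟩
  have hone : allOnes (N + 1) ≠ 0 := fun h0 => by
    simpa [allOnes] using congrArg (fun x : EuclideanSpace ℝ (Fin (N + 1)) => x 0) h0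
  have hrank : Module.finrank ℝ (ℝ ∙ allOnes (N + 1))ᗮ = N :=
    Submodule.finrank_orthogonal_span_singleton hone
  have hmeas : ∀ v : EuclideanSpace ℝ (Fin (N + 1)), MeasurableSet
      {y : (ℝ ∙ allOnes (N + 1))ᗮ | (y : EuclideanSpace ℝ (Fin (N + 1))) + v ∈ graphPolytope G} :=
    fun v => ((isClosed_graphPolytope G).preimage (by fun_prop)).measurableSet
  have hhaar : (Measure.hausdorffMeasure (N : ℝ) :
      Measure (ℝ ∙ allOnes (N + 1))ᗮ).IsAddHaarMeasure := by
    have := isAddHaarMeasure_hausdorffMeasure (E := (ℝ ∙ allOnes (N + 1))ᗮ)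
    rwa [hrank] at this
  simp only [dTilde_eq_hausdorffMeasure_preimage]
  refine measure_mul_measure_le_sq_of_midpoint_mem _ (hmeas _) (hmeas _) (hmeas _)
    fun a ha b hb => ?_
  have := midpoint_mem_graphPolytope G ha hb
  rw [Set.mem_ofPred_eq]
  convert this using 1
  push_cast
  module
end

section
/- For every positive integer m ≥ 1, there exists a finite tree T (a finite connected acyclic simple graph) such that, with γ = γ(T) the domination number of T, one has d_{γ+2j+1}(T)^2 < d_{γ+2j}(T) · d_{γ+2j+2}(T) for all integers j with 0 ≤ j ≤ m−1. In particular the dominating set sequence of T fails log-concavity at at least m indices. -/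
/-- `S` is a dominating set of `G`: every vertex is in `S` or adjacent to a member of `S`. -/
def SimpleGraph.DomSet {V : Type*} (G : SimpleGraph V) (S : Finset V) : Prop :=
  ∀ v, v ∈ S ∨ ∃ u ∈ S, G.Adj u v

/-- `domCount G k` is the number of dominating sets of `G` of cardinality `k`. -/
noncomputable def domCount {V : Type*} [Fintype V] (G : SimpleGraph V) (k : ℕ) : ℕ :=
  Nat.card {S : Finset V // G.DomSet S ∧ S.card = k}

/-- The domination number `γ(G)`: the minimum cardinality of a dominating set of `G`. -/
noncomputable def domNumber {V : Type*} [Fintype V] (G : SimpleGraph V) : ℕ :=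
  sInf {k | ∃ S : Finset V, G.DomSet S ∧ S.card = k}

namespace SimpleGraph

/-- The graph joining every vertex to its image under `f`. -/
def parentGraph {V : Type*} (f : V → V) : SimpleGraph V :=
  SimpleGraph.fromRel fun u v => f u = v

theorem parentGraph_connected {V : Type*} (f : V → V) (r : V) (rank : V → ℕ)
    (h : ∀ v, v ≠ r → rank (f v) < rank v) : (parentGraph f).Connected := by
  have key : ∀ n v, rank v = n → (parentGraph f).Reachable v r := by
    intro n
    induction n using Nat.strong_induction_on with
    | _ n ih =>
      intro v hv
      by_cases hr : v = r
      · rw [hr]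
      · have hlt := h v hr
        have hadj : (parentGraph f).Adj v (f v) := by
          refine (SimpleGraph.fromRel_adj _ _ _).2 ⟨?_, Or.inl rfl⟩
          intro e
          rw [← e] at hlt
          exact lt_irrefl _ hlt
        exact hadj.reachable.trans (ih _ (hv ▸ hlt) _ rfl)
  have : Nonempty V := ⟨r⟩
  exact ⟨fun u v => (key _ u rfl).trans (key _ v rfl).symm⟩

theorem parentGraph_isTree {V : Type*} [Finite V] (f : V → V) (r : V) (rank : V → ℕ)
    (hr : f r = r) (h : ∀ v, v ≠ r → rank (f v) < rank v) : (parentGraph f).IsTree := by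
  classical
  have := Fintype.ofFinite V
  have hc := parentGraph_connected f r rank h
  refine SimpleGraph.isTree_iff_connected_and_card.2 ⟨hc, le_antisymm ?_ ?_⟩
  · have hsub : (parentGraph f).edgeSet ⊆
        (((Finset.univ.erase r).image fun v => s(v, f v) : Finset (Sym2 V)) : Set (Sym2 V)) := by
      intro e
      induction e using Sym2.ind with
      | _ u v =>
        intro he
        obtain ⟨hne, huv⟩ := (SimpleGraph.fromRel_adj _ _ _).1 (SimpleGraph.mem_edgeSet _ |>.1 he)
        simp only [Finset.coe_image, Set.mem_image, Finset.mem_coe, Finset.mem_erase,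
          Finset.mem_univ, and_true]
        rcases huv with huv | huv
        · exact ⟨u, fun e => hne (by rw [← huv, e, hr]), by rw [huv]⟩
        · exact ⟨v, fun e => hne (by rw [← huv, e, hr]), by rw [huv, Sym2.eq_swap]⟩
    have h1 := Set.ncard_le_ncard hsub (Finset.finite_toSet _)
    rw [Set.ncard_coe_finset] at h1
    have h2 := h1.trans Finset.card_image_le
    rw [Finset.card_erase_of_mem (Finset.mem_univ r), Finset.card_univ] at h2
    have h3 : 0 < Fintype.card V := Fintype.card_pos_iff.2 ⟨r⟩
    rw [Nat.card_coe_set_eq, Nat.card_eq_fintype_card]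
    omega
  · exact hc.card_vert_le_card_edgeSet_add_one

end SimpleGraph

theorem domCount_eq_card_filter {V : Type*} [Fintype V] (G : SimpleGraph V) (k : ℕ)
    [DecidablePred fun S : Finset V => G.DomSet S ∧ S.card = k] :
    domCount G k = (Finset.univ.filter fun S : Finset V => G.DomSet S ∧ S.card = k).card := by
  rw [domCount, Nat.card_eq_fintype_card, Fintype.card_subtype]

namespace SpiderTree

open Finset

/-- Indices of knobs: three knobs for each of the `n + 1` hubs. -/
abbrev Knob (n : ℕ) : Type := Fin (n + 1) × Fin 3

/-- Indices of legs: `k` legs for each knob. -/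
abbrev Leg (n k : ℕ) : Type := Knob n × Fin k

/-- Vertices: hubs, knobs, and the inner, middle and outer vertices of the legs. -/
abbrev Vertex (n k : ℕ) : Type := Fin (n + 1) ⊕ Knob n ⊕ Leg n k ⊕ Leg n k ⊕ Leg n k

variable {n k : ℕ}

abbrev hub (i : Fin (n + 1)) : Vertex n k := .inl i
abbrev knob (j : Knob n) : Vertex n k := .inr (.inl j)
abbrev inner (l : Leg n k) : Vertex n k := .inr (.inr (.inl l))
abbrev middle (l : Leg n k) : Vertex n k := .inr (.inr (.inr (.inl l)))
abbrev outer (l : Leg n k) : Vertex n k := .inr (.inr (.inr (.inr l)))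

/-- The parent of a vertex, the hub `0` being the root. -/
def parent : Vertex n k → Vertex n k
  | .inl _ => hub 0
  | .inr (.inl j) => hub j.1
  | .inr (.inr (.inl l)) => knob l.1
  | .inr (.inr (.inr (.inl l))) => inner l
  | .inr (.inr (.inr (.inr l))) => middle l

/-- A function that decreases when passing to the parent. -/
def rank : Vertex n k → ℕ
  | .inl i => i
  | .inr (.inl j) => j.1 + 1
  | .inr (.inr (.inl l)) => l.1.1 + 2
  | .inr (.inr (.inr (.inl l))) => l.1.1 + 3
  | .inr (.inr (.inr (.inr l))) => l.1.1 + 4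

/-- Each of the `n + 1` hubs carries three knobs, each knob carries `k` pendant paths on three
vertices, and all hubs are joined to the hub `0`. -/
def graph (n k : ℕ) : SimpleGraph (Vertex n k) := SimpleGraph.parentGraph parent

theorem graph_isTree (n k : ℕ) : (graph n k).IsTree := by
  refine SimpleGraph.parentGraph_isTree parent (hub 0) rank rfl ?_
  rintro (i | j | l | l | l) h
  · have : i ≠ 0 := fun e => h (by rw [e])
    simpa [parent, rank, Fin.pos_iff_ne_zero] using this
  all_goals simp [parent, rank]

theorem graph_adj {u v : Vertex n k} :
    (graph n k).Adj u v ↔ u ≠ v ∧ (parent u = v ∨ parent v = u) :=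
  SimpleGraph.fromRel_adj _ _ _

def hubs (S : Finset (Vertex n k)) : Finset (Fin (n + 1)) := S.toLeft
def knobs (S : Finset (Vertex n k)) : Finset (Knob n) := S.toRight.toLeft
def inners (S : Finset (Vertex n k)) : Finset (Leg n k) := S.toRight.toRight.toLeft
def middles (S : Finset (Vertex n k)) : Finset (Leg n k) := S.toRight.toRight.toRight.toLeft
def outers (S : Finset (Vertex n k)) : Finset (Leg n k) := S.toRight.toRight.toRight.toRight

theorem card_eq_sum_parts (S : Finset (Vertex n k)) :
    #S = #(hubs S) + #(knobs S) + #(inners S) + #(middles S) + #(outers S) := by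
  unfold hubs knobs inners middles outers
  have h1 := S.card_toLeft_add_card_toRight
  have h2 := S.toRight.card_toLeft_add_card_toRight
  have h3 := S.toRight.toRight.card_toLeft_add_card_toRight
  have h4 := S.toRight.toRight.toRight.card_toLeft_add_card_toRight
  omega

/-- The vertex set with the given hubs, knobs, inner, middle and outer vertices. -/
def assemble (P : Finset (Fin (n + 1))) (Q : Finset (Knob n)) (A W Z : Finset (Leg n k)) :
    Finset (Vertex n k) :=
  P.disjSum (Q.disjSum (A.disjSum (W.disjSum Z)))

theorem card_assemble (P : Finset (Fin (n + 1))) (Q : Finset (Knob n)) (A W Z : Finset (Leg n k)) :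
    #(assemble P Q A W Z) = #P + #Q + #A + #W + #Z := by
  simp only [assemble, card_disjSum]
  ring

theorem assemble_parts (S : Finset (Vertex n k)) :
    assemble (hubs S) (knobs S) (inners S) (middles S) (outers S) = S := by
  simp [assemble, hubs, knobs, inners, middles, outers, toLeft_disjSum_toRight]

/-- What remains of `S` after removing from each leg its middle vertex, or its outer vertex if the
middle one is missing. -/
def surplus (S : Finset (Vertex n k)) : Finset (Vertex n k) :=
  assemble (hubs S) (knobs S) (inners S) ∅ (middles S ∩ outers S)

theorem hubs_surplus (S : Finset (Vertex n k)) : hubs (surplus S) = hubs S := by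
  simp [surplus, assemble, hubs]

theorem knobs_surplus (S : Finset (Vertex n k)) : knobs (surplus S) = knobs S := by
  simp [surplus, assemble, knobs]

theorem inners_surplus (S : Finset (Vertex n k)) : inners (surplus S) = inners S := by
  simp [surplus, assemble, inners]

theorem outers_surplus (S : Finset (Vertex n k)) :
    outers (surplus S) = middles S ∩ outers S := by
  ext l
  simp [surplus, assemble, outers]

theorem knob_dominated {S : Finset (Vertex n k)} (hS : (graph n k).DomSet S) (j : Knob n) :
    j ∈ knobs S ∨ j.1 ∈ hubs S ∨ ∃ l ∈ inners S, l.1 = j := by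
  rcases hS (knob j) with h | ⟨u, hu, h⟩
  · exact Or.inl (by simpa [knobs] using h)
  · obtain ⟨-, h⟩ := graph_adj.1 h
    rcases u with i | j' | l | l | l <;> simp [parent] at h <;> simp_all [hubs, inners]
    subst h
    exact Or.inr (Or.inr ⟨_, hu⟩)

theorem inner_dominated {S : Finset (Vertex n k)} (hS : (graph n k).DomSet S)
    (l : Leg n k) : l ∈ inners S ∨ l.1 ∈ knobs S ∨ l ∈ middles S := by
  rcases hS (inner l) with h | ⟨u, hu, h⟩
  · exact Or.inl (by simpa [inners] using h)
  · obtain ⟨-, h⟩ := graph_adj.1 h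
    rcases u with i | j' | l | l | l <;> simp [parent] at h <;> simp_all [knobs, middles]

theorem outer_dominated {S : Finset (Vertex n k)} (hS : (graph n k).DomSet S)
    (l : Leg n k) : l ∈ outers S ∨ l ∈ middles S := by
  rcases hS (outer l) with h | ⟨u, hu, h⟩
  · exact Or.inl (by simpa [outers] using h)
  · obtain ⟨-, h⟩ := graph_adj.1 h
    rcases u with i | j' | l | l | l <;> simp [parent] at h <;> simp_all [middles]

theorem middles_union_outers {S : Finset (Vertex n k)} (hS : (graph n k).DomSet S) :
    middles S ∪ outers S = univ := by
  ext l
  have := outer_dominated hS l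
  simp only [mem_union, mem_univ, iff_true]
  tauto

theorem card_eq_of_domSet {S : Finset (Vertex n k)} (hS : (graph n k).DomSet S) :
    #S = #(hubs S) + #(knobs S) + #(inners S) + #(middles S ∩ outers S) + 3 * (n + 1) * k := by
  have h := card_union_add_card_inter (middles S) (outers S)
  have h2 := card_eq_sum_parts S
  rw [middles_union_outers hS, card_univ] at h
  simp only [Fintype.card_prod, Fintype.card_fin] at h
  rw [mul_comm (n + 1) 3] at h
  omega

theorem three_mul_succ_le {S : Finset (Vertex n k)} (hS : (graph n k).DomSet S) :
    3 * (n + 1) ≤ 3 * #(hubs S) + #(knobs S) + #(inners S) := by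
  have hsub : (univ : Finset (Knob n)) ⊆
      (hubs S ×ˢ univ) ∪ knobs S ∪ (inners S).image Prod.fst := by
    intro j _
    have := knob_dominated hS j
    simp only [mem_union, mem_product, mem_univ, and_true, mem_image]
    tauto
  have h := card_le_card hsub
  have h1 := card_union_le ((hubs S ×ˢ (univ : Finset (Fin 3))) ∪ knobs S)
    ((inners S).image Prod.fst)
  have h2 := card_union_le (hubs S ×ˢ (univ : Finset (Fin 3))) (knobs S)
  have h3 := card_image_le (s := inners S) (f := Prod.fst)
  simp only [card_univ, Fintype.card_prod, Fintype.card_fin, card_product] at h h1 h2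
  omega

/-- The first `j` hubs are replaced by their knobs, and every leg `l` contributes its outer vertex
if `l ∈ B` and its middle vertex otherwise. -/
def knobbed (j : ℕ) (B : Finset (Leg n k)) : Finset (Vertex n k) :=
  assemble (univ.filter fun i => ¬ (i : ℕ) < j)
    ((univ.filter fun i : Fin (n + 1) => (i : ℕ) < j) ×ˢ univ)
    ∅ Bᶜ B

theorem card_filter_lt {j : ℕ} (hj : j ≤ n + 1) :
    #(univ.filter fun i : Fin (n + 1) => (i : ℕ) < j) = j := by
  rw [Fin.card_filter_val_lt]
  omega

theorem card_knobbed {j : ℕ} (hj : j ≤ n + 1) (B : Finset (Leg n k)) :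
    #(knobbed j B) = 3 * (n + 1) * k + (n + 1) + 2 * j := by
  have h1 := card_filter_add_card_filter_not (s := (univ : Finset (Fin (n + 1))))
    (fun i => (i : ℕ) < j)
  have h2 := card_add_card_compl B
  rw [knobbed, card_assemble]
  simp only [card_product, card_filter_lt hj, card_univ, Fintype.card_fin, card_empty,
    Fintype.card_prod] at h1 h2 ⊢
  rw [mul_comm (n + 1) 3] at h2
  omega

theorem domSet_knobbed (j : ℕ) {B : Finset (Leg n k)} (hB : ∀ l ∈ B, (l.1.1 : ℕ) < j) :
    (graph n k).DomSet (knobbed j B) := by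
  have hmem : ∀ i : Fin (n + 1), ¬ (i : ℕ) < j → hub i ∈ knobbed j B := by
    intro i hi
    simpa [knobbed, assemble] using hi
  have kmem : ∀ q : Knob n, (q.1 : ℕ) < j → knob q ∈ knobbed j B := by
    intro i hi
    simpa [knobbed, assemble] using hi
  have mmem : ∀ l, l ∉ B → middle l ∈ knobbed j B := by
    intro l hl
    simpa [knobbed, assemble] using hl
  have omem : ∀ l, l ∈ B → outer l ∈ knobbed j B := by
    intro l hl
    simpa [knobbed, assemble] using hl
  rintro (i | q | l | l | l)
  · by_cases h : (i : ℕ) < j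
    · exact Or.inr ⟨knob (i, 0), kmem _ h, by simp [graph_adj, parent]⟩
    · exact Or.inl (hmem _ h)
  · by_cases h : (q.1 : ℕ) < j
    · exact Or.inl (kmem _ h)
    · exact Or.inr ⟨hub q.1, hmem _ h, by simp [graph_adj, parent]⟩
  · by_cases h : l ∈ B
    · exact Or.inr ⟨knob l.1, kmem _ (hB l h), by simp [graph_adj, parent]⟩
    · exact Or.inr ⟨middle l, mmem _ h, by simp [graph_adj, parent]⟩
  · by_cases h : l ∈ B
    · exact Or.inr ⟨outer l, omem _ h, by simp [graph_adj, parent]⟩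
    · exact Or.inl (mmem _ h)
  · by_cases h : l ∈ B
    · exact Or.inl (omem _ h)
    · exact Or.inr ⟨middle l, mmem _ h, by simp [graph_adj, parent]⟩

theorem domNumber_graph (n k : ℕ) : domNumber (graph n k) = 3 * (n + 1) * k + (n + 1) := by
  refine IsLeast.csInf_eq ⟨⟨knobbed 0 ∅, domSet_knobbed 0 (by simp), ?_⟩, ?_⟩
  · simpa using card_knobbed (n := n) (k := k) (Nat.zero_le _) ∅
  · rintro _ ⟨S, hS, rfl⟩
    have h1 := card_eq_of_domSet hS
    have h2 := three_mul_succ_le hS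
    omega

theorem knobbed_injective (j : ℕ) :
    Function.Injective (knobbed j : Finset (Leg n k) → Finset (Vertex n k)) := by
  intro B C h
  ext l
  have : outer l ∈ knobbed j B ↔ outer l ∈ knobbed j C := by rw [h]
  simpa [knobbed, assemble] using this

theorem two_pow_le_domCount {j : ℕ} (hj : j ≤ n + 1) :
    2 ^ (3 * j * k) ≤ domCount (graph n k) (3 * (n + 1) * k + (n + 1) + 2 * j) := by
  classical
  rw [domCount_eq_card_filter]
  have hcard : #(((univ.filter fun i : Fin (n + 1) => (i : ℕ) < j) ×ˢ (univ : Finset (Fin 3))) ×ˢ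
      (univ : Finset (Fin k))) = 3 * j * k := by
    simp only [card_product, card_filter_lt hj, card_univ, Fintype.card_fin]
    ring
  rw [← hcard, ← card_powerset]
  refine card_le_card_of_injOn (knobbed j) ?_ (knobbed_injective j).injOn
  intro B hB
  have hB' : ∀ l ∈ B, (l.1.1 : ℕ) < j := by
    intro l hl
    simpa using mem_powerset.1 hB hl
  simp [domSet_knobbed j hB', card_knobbed hj]

theorem card_surplus {S : Finset (Vertex n k)} (hS : (graph n k).DomSet S) :
    #(surplus S) + 3 * (n + 1) * k = #S := by
  rw [surplus, card_assemble, card_eq_of_domSet hS, card_empty]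
  ring

theorem eq_of_surplus_eq {S T : Finset (Vertex n k)} (hS : (graph n k).DomSet S)
    (hT : (graph n k).DomSet T) (h : surplus S = surplus T) (hm : middles S = middles T) :
    S = T := by
  have hP := congrArg hubs h
  have hQ := congrArg knobs h
  have hA := congrArg inners h
  have hX := congrArg outers h
  rw [hubs_surplus, hubs_surplus] at hP
  rw [knobs_surplus, knobs_surplus] at hQ
  rw [inners_surplus, inners_surplus] at hA
  rw [outers_surplus, outers_surplus] at hX
  have hZ : outers S = outers T := by
    ext l
    have h1 := outer_dominated hS l
    have h2 := outer_dominated hT l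
    have h3 := Finset.ext_iff.1 hX l
    simp only [mem_inter] at h3
    rw [hm] at h1 h3
    tauto
  rw [← assemble_parts S, ← assemble_parts T, hP, hQ, hA, hm, hZ]

theorem card_product_univ_union_le (Q : Finset (Knob n)) (A : Finset (Leg n k)) :
    #(Q ×ˢ (univ : Finset (Fin k)) ∪ A) ≤ #Q * k + #A := by
  refine (card_union_le _ _).trans ?_
  simp

theorem domCount_le (n k j : ℕ) :
    domCount (graph n k) (3 * (n + 1) * k + (n + 1) + 2 * j + 1) ≤
      2 ^ ((3 * j + 1) * k + (n + 2 * j + 2)) *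
        Fintype.card (Vertex n k) ^ (n + 2 * j + 2) := by
  classical
  rw [domCount_eq_card_filter]
  set 𝒮 := univ.filter fun S : Finset (Vertex n k) =>
    (graph n k).DomSet S ∧ #S = 3 * (n + 1) * k + (n + 1) + 2 * j + 1
  have hmem : ∀ S ∈ 𝒮, (graph n k).DomSet S ∧ #(surplus S) = n + 2 * j + 2 := by
    intro S hS
    obtain ⟨hd, hc⟩ := (mem_filter.1 hS).2
    have := card_surplus hd
    exact ⟨hd, by omega⟩
  have himage : #(𝒮.image surplus) ≤ Fintype.card (Vertex n k) ^ (n + 2 * j + 2) := by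
    have hsub : 𝒮.image surplus ⊆ powersetCard (n + 2 * j + 2) univ := by
      intro X hX
      obtain ⟨S, hS, rfl⟩ := mem_image.1 hX
      exact mem_powersetCard.2 ⟨subset_univ _, (hmem S hS).2⟩
    refine (card_le_card hsub).trans ?_
    rw [card_powersetCard, card_univ]
    exact Nat.choose_le_pow _ _
  refine (card_le_mul_card_image 𝒮 _ ?_).trans (Nat.mul_le_mul_left _ himage)
  intro X hX
  obtain ⟨S₀, hS₀, rfl⟩ := mem_image.1 hX
  obtain ⟨hd₀, hc₀⟩ := hmem S₀ hS₀
  have hexp : #(knobs S₀ ×ˢ (univ : Finset (Fin k)) ∪ inners S₀) ≤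
      (3 * j + 1) * k + (n + 2 * j + 2) := by
    have h1 := three_mul_succ_le hd₀
    rw [surplus, card_assemble, card_empty] at hc₀
    refine (card_product_univ_union_le _ _).trans ?_
    have h2 : #(knobs S₀) ≤ 3 * j + 1 := by omega
    have h3 : #(inners S₀) ≤ n + 2 * j + 2 := by omega
    gcongr
  refine le_trans ?_ (Nat.pow_le_pow_right two_pos hexp)
  rw [← card_powerset]
  refine card_le_card_of_injOn (fun S => (middles S)ᶜ) ?_ ?_
  · intro S hS
    obtain ⟨hS, hX⟩ := mem_filter.1 hS
    have hQ := congrArg knobs hX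
    have hA := congrArg inners hX
    rw [knobs_surplus, knobs_surplus] at hQ
    rw [inners_surplus, inners_surplus] at hA
    refine mem_coe.2 (mem_powerset.2 fun l hl => ?_)
    have := inner_dominated (hmem S hS).1 l
    rw [hQ, hA] at this
    simp only [mem_compl] at hl
    simp only [mem_union, mem_product, mem_univ, and_true]
    tauto
  · intro S hS T hT h
    obtain ⟨hS, hXS⟩ := mem_filter.1 hS
    obtain ⟨hT, hXT⟩ := mem_filter.1 hT
    exact eq_of_surplus_eq (hmem S hS).1 (hmem T hT).1 (hXS.trans hXT.symm) (compl_injective h)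

theorem card_vertex_le (n : ℕ) (hk : 1 ≤ k) :
    Fintype.card (Vertex n k) ≤ 13 * (n + 1) * k := by
  simp only [Fintype.card_sum, Fintype.card_prod, Fintype.card_fin]
  nlinarith

theorem exists_pow_lt_two_pow (C d : ℕ) : ∃ k : ℕ, 1 ≤ k ∧ (C * k) ^ d < 2 ^ k := by
  have ht := (tendsto_pow_const_div_const_pow_of_one_lt d (one_lt_two : (1 : ℝ) < 2)).const_mul
    ((C : ℝ) ^ d)
  rw [mul_zero] at ht
  obtain ⟨k, hlt, hk⟩ :=
    ((ht.eventually_lt_const one_pos).and (Filter.eventually_ge_atTop 1)).exists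
  refine ⟨k, hk, ?_⟩
  rw [← mul_div_assoc, div_lt_one (by positivity), ← mul_pow] at hlt
  exact_mod_cast hlt

end SpiderTree

/-- For every `m ≥ 1` there exists a finite tree whose dominating set sequence fails
log-concavity at the `m` indices `γ+1, γ+3, …, γ+2m-1`:
`d_{γ+2j+1}^2 < d_{γ+2j} ⬝ d_{γ+2j+2}` for all `0 ≤ j ≤ m-1`. -/
theorem exists_tree_many_log_concavity_failures (m : ℕ) (hm : 1 ≤ m) :
    ∃ (V : Type) (inst : Fintype V) (T : SimpleGraph V),
      T.Connected ∧ T.IsAcyclic ∧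
      ∀ j : ℕ, j < m →
        (@domCount V inst T (@domNumber V inst T + 2 * j + 1)) ^ 2 <
          (@domCount V inst T (@domNumber V inst T + 2 * j)) *
            (@domCount V inst T (@domNumber V inst T + 2 * j + 2)) := by
  obtain ⟨n, rfl⟩ : ∃ n, m = n + 1 := ⟨m - 1, by omega⟩
  obtain ⟨k, hk, hlt⟩ := SpiderTree.exists_pow_lt_two_pow (26 * (n + 1)) (6 * (n + 1))
  have htree := SpiderTree.graph_isTree n k
  refine ⟨SpiderTree.Vertex n k, inferInstance, SpiderTree.graph n k, htree.1, htree.2, ?_⟩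
  intro j hj
  rw [SpiderTree.domNumber_graph]
  have hupper := SpiderTree.domCount_le n k j
  have hlow := SpiderTree.two_pow_le_domCount (k := k) hj.le
  have hhigh := SpiderTree.two_pow_le_domCount (k := k) (Nat.succ_le_of_lt hj)
  have hcard := SpiderTree.card_vertex_le n hk
  set N := Fintype.card (SpiderTree.Vertex n k)
  have hbase : 1 ≤ 26 * (n + 1) * k := Nat.mul_pos (by omega) hk
  have hpoly : (2 * N) ^ (2 * (n + 2 * j + 2)) < 2 ^ k :=
    calc (2 * N) ^ (2 * (n + 2 * j + 2)) ≤ (26 * (n + 1) * k) ^ (2 * (n + 2 * j + 2)) :=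
          Nat.pow_le_pow_left (by linarith) _
      _ ≤ (26 * (n + 1) * k) ^ (6 * (n + 1)) := Nat.pow_le_pow_right hbase (by omega)
      _ < 2 ^ k := hlt
  calc _ ≤ (2 ^ ((3 * j + 1) * k + (n + 2 * j + 2)) * N ^ (n + 2 * j + 2)) ^ 2 :=
        Nat.pow_le_pow_left hupper 2
    _ = 2 ^ ((6 * j + 2) * k) * (2 * N) ^ (2 * (n + 2 * j + 2)) := by ring
    _ < 2 ^ ((6 * j + 2) * k) * 2 ^ k := Nat.mul_lt_mul_of_pos_left hpoly (by positivity)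
    _ = 2 ^ (3 * j * k) * 2 ^ (3 * (j + 1) * k) := by ring
    _ ≤ _ := Nat.mul_le_mul hlow hhigh
end

section
/- Fix an integer m ≥ 1. Then there exists t_0 such that for all integers t ≥ t_0, the tree W_{m,t} satisfies: writing γ = γ(W_{m,t}) for its domination number, d_{γ+2j+1}(W_{m,t})^2 < d_{γ+2j}(W_{m,t}) · d_{γ+2j+2}(W_{m,t}) for every j = 0,1,…,m−1. -/
/-- Vertices of the rooted gadget `F_t`: a root together with `t` copies of the rooted
three-vertex path `L`. -/
def FVert (t : ℕ) : Type := Unit ⊕ (Fin t × Fin 3)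

instance (t : ℕ) : Fintype (FVert t) := by unfold FVert; infer_instance

/-- Base edge relation of `F_t`: the root is joined to the root (vertex `0`) of each copy of
`L`, and each copy of `L` carries path edges `0-1-2`. -/
def FRel (t : ℕ) (x y : FVert t) : Prop :=
  (∃ ℓ : Fin t, x = Sum.inl () ∧ y = Sum.inr (ℓ, 0)) ∨
  (∃ (ℓ : Fin t) (a b : Fin 3), (SimpleGraph.pathGraph 3).Adj a b ∧
    x = Sum.inr (ℓ, a) ∧ y = Sum.inr (ℓ, b))

/-- The rooted tree `F_t` (root `Sum.inl ()`). -/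
def Ftree (t : ℕ) : SimpleGraph (FVert t) := SimpleGraph.fromRel (FRel t)

/-- Vertices of the rooted gadget `H_t`: a root together with three copies of `F_t`. -/
def HVert (t : ℕ) : Type := Unit ⊕ (Fin 3 × FVert t)

instance (t : ℕ) : Fintype (HVert t) := by unfold HVert; infer_instance

/-- Base edge relation of `H_t`: the root is joined to the root of each of three copies of
`F_t`, and each copy carries the edges of `F_t`. -/
def HRel (t : ℕ) (x y : HVert t) : Prop :=
  (∃ b : Fin 3, x = Sum.inl () ∧ y = Sum.inr (b, Sum.inl ())) ∨
  (∃ (b : Fin 3) (p q : FVert t), (Ftree t).Adj p q ∧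
    x = Sum.inr (b, p) ∧ y = Sum.inr (b, q))

/-- The rooted tree `H_t` (root `Sum.inl ()`). -/
def Htree (t : ℕ) : SimpleGraph (HVert t) := SimpleGraph.fromRel (HRel t)

/-- Vertices of `W_{m,t}`: a root, `m` copies of `H_t`, and one copy of the rooted
two-vertex path `X`. -/
def WVert (m t : ℕ) : Type := Unit ⊕ ((Fin m × HVert t) ⊕ Fin 2)

instance (m t : ℕ) : Fintype (WVert m t) := by unfold WVert; infer_instance

/-- Base edge relation of `W_{m,t}`: the root is joined to the root of each copy of `H_t`
and to the root (vertex `0`) of the copy of `X`; each copy of `H_t` carries the edges of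
`H_t`; and `X` carries its single edge `0-1`. -/
def WRel (m t : ℕ) (x y : WVert m t) : Prop :=
  (∃ i : Fin m, x = Sum.inl () ∧ y = Sum.inr (Sum.inl (i, Sum.inl ()))) ∨
  (x = Sum.inl () ∧ y = Sum.inr (Sum.inr 0)) ∨
  (∃ (i : Fin m) (p q : HVert t), (Htree t).Adj p q ∧
    x = Sum.inr (Sum.inl (i, p)) ∧ y = Sum.inr (Sum.inl (i, q))) ∨
  (x = Sum.inr (Sum.inr 0) ∧ y = Sum.inr (Sum.inr 1))

/-- The tree `W_{m,t}`. -/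
def Wtree (m t : ℕ) : SimpleGraph (WVert m t) := SimpleGraph.fromRel (WRel m t)

namespace Wtree

variable {m t : ℕ}

/-- The root of `W_{m,t}`. -/
def root : WVert m t := Sum.inl ()

/-- The vertices of the copy of `X`. -/
def xVert (k : Fin 2) : WVert m t := Sum.inr (Sum.inr k)

/-- The root of the `i`-th copy of `H_t`. -/
def hVert (i : Fin m) : WVert m t := Sum.inr (Sum.inl (i, Sum.inl ()))

/-- The root of the `f`-th copy of `F_t` in the `i`-th copy of `H_t`. -/
def fVert (i : Fin m) (f : Fin 3) : WVert m t :=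
  Sum.inr (Sum.inl (i, Sum.inr (f, Sum.inl ())))

/-- The vertices of the copies of `L`, which are indexed by `p`. -/
def lVert (p : Fin m × Fin 3 × Fin t) (k : Fin 3) : WVert m t :=
  Sum.inr (Sum.inl (p.1, Sum.inr (p.2.1, Sum.inr (p.2.2, k))))

theorem cases_vert {P : WVert m t → Prop} (x : WVert m t) (root : P root)
    (x0 : P (xVert 0)) (x1 : P (xVert 1)) (h : ∀ i, P (hVert i)) (f : ∀ i f, P (fVert i f))
    (l0 : ∀ p, P (lVert p 0)) (l1 : ∀ p, P (lVert p 1)) (l2 : ∀ p, P (lVert p 2)) : P x := by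
  rcases x with ⟨⟩ | ⟨i, ⟨⟩ | ⟨b, ⟨⟩ | ⟨l, k⟩⟩⟩ | k
  · exact root
  · exact h i
  · exact f i b
  · fin_cases k
    exacts [l0 (i, b, l), l1 (i, b, l), l2 (i, b, l)]
  · fin_cases k
    exacts [x0, x1]

theorem lVert_injective (k : Fin 3) : Function.Injective fun p => lVert (m := m) (t := t) p k := by
  rintro ⟨i, f, l⟩ ⟨i', f', l'⟩ h
  simp only [lVert] at h
  cases h
  rfl

theorem lVert_ne {p q : Fin m × Fin 3 × Fin t} {k k' : Fin 3} (h : k ≠ k') :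
    lVert p k ≠ lVert q k' := by
  obtain ⟨i, f, l⟩ := p
  obtain ⟨i', f', l'⟩ := q
  intro e
  simp only [lVert] at e
  cases e
  exact h rfl

theorem fVert_ne_lVert {i : Fin m} {f : Fin 3} {q : Fin m × Fin 3 × Fin t} {k : Fin 3} :
    fVert i f ≠ lVert q k := by
  intro e
  cases e

theorem adj_xVert_zero_root : (Wtree m t).Adj (xVert 0) root :=
  ⟨fun e => (nomatch e), Or.inr (Or.inr (Or.inl ⟨rfl, rfl⟩))⟩

theorem adj_xVert_zero_one : (Wtree m t).Adj (xVert 0) (xVert 1) :=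
  ⟨fun e => (nomatch e), Or.inl (Or.inr (Or.inr (Or.inr ⟨rfl, rfl⟩)))⟩

theorem adj_of_Htree (i : Fin m) {p q : HVert t} (h : (Htree t).Adj p q) :
    (Wtree m t).Adj (Sum.inr (Sum.inl (i, p))) (Sum.inr (Sum.inl (i, q))) :=
  ⟨fun e => h.ne (by cases e; rfl), Or.inl (Or.inr (Or.inr (Or.inl ⟨i, p, q, h, rfl, rfl⟩)))⟩

theorem adj_of_Ftree (i : Fin m) (f : Fin 3) {p q : FVert t} (h : (Ftree t).Adj p q) :
    (Wtree m t).Adj (Sum.inr (Sum.inl (i, Sum.inr (f, p)))) (Sum.inr (Sum.inl (i, Sum.inr (f, q)))) :=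
  adj_of_Htree i ⟨fun e => h.ne (by cases e; rfl), Or.inl (Or.inr ⟨f, p, q, h, rfl, rfl⟩)⟩

theorem adj_hVert_fVert (i : Fin m) (f : Fin 3) : (Wtree m t).Adj (hVert i) (fVert i f) :=
  adj_of_Htree i ⟨fun e => (nomatch e), Or.inl (Or.inl ⟨f, rfl, rfl⟩)⟩

theorem adj_fVert_lVert (p : Fin m × Fin 3 × Fin t) :
    (Wtree m t).Adj (fVert p.1 p.2.1) (lVert p 0) :=
  adj_of_Ftree p.1 p.2.1 ⟨fun e => (nomatch e), Or.inl (Or.inl ⟨p.2.2, rfl, rfl⟩)⟩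

theorem adj_lVert (p : Fin m × Fin 3 × Fin t) {k k' : Fin 3}
    (h : (SimpleGraph.pathGraph 3).Adj k k') : (Wtree m t).Adj (lVert p k) (lVert p k') :=
  adj_of_Ftree p.1 p.2.1
    ⟨fun e => h.ne (by cases e; rfl), Or.inl (Or.inr ⟨p.2.2, k, k', h, rfl, rfl⟩)⟩

theorem xVert_mem_of_domSet {S : Finset (WVert m t)} (hS : (Wtree m t).DomSet S) :
    xVert 0 ∈ S ∨ xVert 1 ∈ S := by
  rcases hS (xVert 1) with h | ⟨x, hx, hne, h⟩
  · exact Or.inr h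
  · left
    rcases h with (⟨i, h, e⟩ | ⟨h, e⟩ | ⟨i, p, q, h, h', e⟩ | ⟨rfl, e⟩) |
      (⟨i, e, h⟩ | ⟨e, h⟩ | ⟨i, p, q, h, e, h'⟩ | ⟨e, h⟩) <;> try cases e
    exact hx

theorem Ftree_adj_inl {x : FVert t} (h : (Ftree t).Adj x (Sum.inl ())) :
    ∃ l, x = Sum.inr (l, 0) := by
  rcases h with ⟨-, (⟨l, h, e⟩ | ⟨l, a, b, h, h', e⟩) | (⟨l, e, h⟩ | ⟨l, a, b, h, e, h'⟩)⟩ <;>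
    try cases e
  exact ⟨l, h⟩

theorem Ftree_adj_inr {x : FVert t} {l : Fin t} {k : Fin 3}
    (h : (Ftree t).Adj x (Sum.inr (l, k))) :
    (x = Sum.inl () ∧ k = 0) ∨
      ∃ k', x = Sum.inr (l, k') ∧ (SimpleGraph.pathGraph 3).Adj k' k := by
  rcases h with ⟨-, (⟨l, h, e⟩ | ⟨l, a, b, h, h', e⟩) | (⟨l, e, h⟩ | ⟨l, a, b, h, e, h'⟩)⟩ <;>
    cases e
  exacts [Or.inl ⟨h, rfl⟩, Or.inr ⟨a, h', h⟩, Or.inr ⟨b, h', h.symm⟩]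

theorem Htree_adj_inr {x : HVert t} {f : Fin 3} {q : FVert t}
    (h : (Htree t).Adj x (Sum.inr (f, q))) :
    (x = Sum.inl () ∧ q = Sum.inl ()) ∨ ∃ q', x = Sum.inr (f, q') ∧ (Ftree t).Adj q' q := by
  rcases h with ⟨-, (⟨l, h, e⟩ | ⟨l, a, b, h, h', e⟩) | (⟨l, e, h⟩ | ⟨l, a, b, h, e, h'⟩)⟩ <;>
    cases e
  exacts [Or.inl ⟨h, rfl⟩, Or.inr ⟨a, h', h⟩, Or.inr ⟨b, h', h.symm⟩]

theorem adj_inr_inl {x : WVert m t} {i : Fin m} {q : HVert t}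
    (h : (Wtree m t).Adj x (Sum.inr (Sum.inl (i, q)))) :
    (x = root ∧ q = Sum.inl ()) ∨
      ∃ q', x = Sum.inr (Sum.inl (i, q')) ∧ (Htree t).Adj q' q := by
  rcases h with ⟨-, (⟨i, h, e⟩ | ⟨h, e⟩ | ⟨i, p, q, h, h', e⟩ | ⟨h, e⟩) |
      (⟨i, e, h⟩ | ⟨e, h⟩ | ⟨i, p, q, h, e, h'⟩ | ⟨e, h⟩)⟩ <;> cases e
  exacts [Or.inl ⟨h, rfl⟩, Or.inr ⟨p, h', h⟩, Or.inr ⟨q, h', h.symm⟩]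

theorem eq_or_exists_eq_of_adj_fVert {x : WVert m t} {i : Fin m} {f : Fin 3}
    (h : (Wtree m t).Adj x (fVert i f)) :
    x = hVert i ∨ ∃ l, x = lVert (i, f, l) 0 := by
  rcases adj_inr_inl h with ⟨-, e⟩ | ⟨q, rfl, hq⟩
  · cases e
  rcases Htree_adj_inr hq with ⟨rfl, -⟩ | ⟨q, rfl, hf⟩
  · exact Or.inl rfl
  · obtain ⟨l, rfl⟩ := Ftree_adj_inl hf
    exact Or.inr ⟨l, rfl⟩

theorem eq_or_exists_eq_of_adj_lVert {x : WVert m t} {p : Fin m × Fin 3 × Fin t} {k : Fin 3}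
    (h : (Wtree m t).Adj x (lVert p k)) :
    (x = fVert p.1 p.2.1 ∧ k = 0) ∨
      ∃ k', x = lVert p k' ∧ (SimpleGraph.pathGraph 3).Adj k' k := by
  rcases adj_inr_inl h with ⟨-, e⟩ | ⟨q, rfl, hq⟩
  · cases e
  rcases Htree_adj_inr hq with ⟨-, e⟩ | ⟨q, rfl, hf⟩
  · cases e
  rcases Ftree_adj_inr hf with ⟨rfl, hk⟩ | ⟨k', rfl, hk⟩
  · exact Or.inl ⟨rfl, hk⟩
  · exact Or.inr ⟨k', rfl, hk⟩

theorem lVert_one_or_two_mem_of_domSet {S : Finset (WVert m t)} (hS : (Wtree m t).DomSet S)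
    (p : Fin m × Fin 3 × Fin t) : lVert p 1 ∈ S ∨ lVert p 2 ∈ S := by
  rcases hS (lVert p 2) with h | ⟨x, hx, h⟩
  · exact Or.inr h
  · rcases eq_or_exists_eq_of_adj_lVert h with ⟨-, h⟩ | ⟨k, rfl, h⟩
    · simp at h
    · fin_cases k <;> simp_all [SimpleGraph.pathGraph_adj]

theorem lVert_zero_mem_of_domSet {S : Finset (WVert m t)} (hS : (Wtree m t).DomSet S)
    (p : Fin m × Fin 3 × Fin t) : lVert p 0 ∈ S ∨ lVert p 1 ∈ S ∨ fVert p.1 p.2.1 ∈ S := by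
  rcases hS (lVert p 0) with h | ⟨x, hx, h⟩
  · exact Or.inl h
  · rcases eq_or_exists_eq_of_adj_lVert h with ⟨rfl, -⟩ | ⟨k, rfl, h⟩
    · exact Or.inr (Or.inr hx)
    · fin_cases k <;> simp_all [SimpleGraph.pathGraph_adj]

theorem fVert_mem_of_domSet {S : Finset (WVert m t)} (hS : (Wtree m t).DomSet S)
    (i : Fin m) (f : Fin 3) : fVert i f ∈ S ∨ hVert i ∈ S ∨ ∃ l, lVert (i, f, l) 0 ∈ S := by
  rcases hS (fVert i f) with h | ⟨x, hx, h⟩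
  · exact Or.inl h
  · rcases eq_or_exists_eq_of_adj_fVert h with rfl | ⟨l, rfl⟩
    · exact Or.inr (Or.inl hx)
    · exact Or.inr (Or.inr ⟨l, hx⟩)

theorem sum_vert (g : WVert m t → ℕ) :
    ∑ x, g x = g root + g (xVert 0) + g (xVert 1) + ∑ i, (g (hVert i) +
      ∑ f, (g (fVert i f) + ∑ l, (g (lVert (i, f, l) 0) + g (lVert (i, f, l) 1) +
        g (lVert (i, f, l) 2)))) := by
  let eF : Unit ⊕ (Fin t × Fin 3) ≃ FVert t := Equiv.refl _
  let eH : Unit ⊕ (Fin 3 × FVert t) ≃ HVert t := Equiv.refl _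
  let eW : Unit ⊕ ((Fin m × HVert t) ⊕ Fin 2) ≃ WVert m t := Equiv.refl _
  have hF (g : FVert t → ℕ) : ∑ x, g x = g (eF (Sum.inl ())) + ∑ l, (g (eF (Sum.inr (l, 0))) +
      g (eF (Sum.inr (l, 1))) + g (eF (Sum.inr (l, 2)))) := by
    rw [← eF.sum_comp, Fintype.sum_sum_type, Fintype.sum_prod_type]
    simp [Fin.sum_univ_three]
  have hH (g : HVert t → ℕ) :
      ∑ x, g x = g (eH (Sum.inl ())) + ∑ f, ∑ x, g (eH (Sum.inr (f, x))) := by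
    rw [← eH.sum_comp, Fintype.sum_sum_type, Fintype.sum_prod_type]
    simp
  rw [← eW.sum_comp, Fintype.sum_sum_type, Fintype.sum_sum_type, Fintype.sum_prod_type]
  simp only [hH, hF, Finset.univ_unique, Finset.sum_singleton, Fin.sum_univ_two]
  change g root + (_ + (g (xVert 0) + g (xVert 1))) = _
  rw [add_comm (∑ i, _), ← add_assoc, ← add_assoc]
  rfl

theorem card_eq_sum [DecidableEq (WVert m t)] (S : Finset (WVert m t)) :
    S.card = (if root ∈ S then 1 else 0) + (if xVert 0 ∈ S then 1 else 0) +
      (if xVert 1 ∈ S then 1 else 0) + ∑ i, ((if hVert i ∈ S then 1 else 0) +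
        ∑ f, ((if fVert i f ∈ S then 1 else 0) + ∑ l, ((if lVert (i, f, l) 0 ∈ S then 1 else 0) +
          (if lVert (i, f, l) 1 ∈ S then 1 else 0) + if lVert (i, f, l) 2 ∈ S then 1 else 0))) := by
  rw [← sum_vert fun x => if x ∈ S then 1 else 0, ← Finset.card_filter]
  simp

theorem card_vert : Fintype.card (WVert m t) = m * (9 * t + 4) + 3 := by
  rw [← Finset.card_univ, Finset.card_eq_sum_ones, sum_vert]
  simp
  ring

open Classical in
/-- A dominating set of size `m (3 t + 1) + 1 + k` contains at most `3 k / 2` roots of copies of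
`F_t`. -/
theorem two_mul_sum_fVert_add_le {S : Finset (WVert m t)} (hS : (Wtree m t).DomSet S) :
    2 * ∑ i, ∑ f, (if fVert i f ∈ S then 1 else 0) + 3 * (m * (3 * t + 1) + 1) ≤ 3 * S.card := by
  have hX : 1 ≤ (if xVert 0 ∈ S then 1 else 0) + (if xVert 1 ∈ S then 1 else 0) := by
    have := xVert_mem_of_domSet hS
    grind
  have hL (i : Fin m) (f : Fin 3) : t + ∑ l, (if lVert (i, f, l) 0 ∈ S then 1 else 0) ≤
      ∑ l, ((if lVert (i, f, l) 0 ∈ S then 1 else 0) +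
        (if lVert (i, f, l) 1 ∈ S then 1 else 0) + if lVert (i, f, l) 2 ∈ S then 1 else 0) := by
    calc _ = ∑ l, (1 + if lVert (i, f, l) 0 ∈ S then 1 else 0) := by simp [Finset.sum_add_distrib]
      _ ≤ _ := by
        refine Finset.sum_le_sum fun l _ => ?_
        have := lVert_one_or_two_mem_of_domSet hS (i, f, l)
        grind
  have hF (i : Fin m) (f : Fin 3) (hi : hVert i ∉ S) : 1 ≤ (if fVert i f ∈ S then 1 else 0) +
      ∑ l, (if lVert (i, f, l) 0 ∈ S then 1 else 0) := by
    rcases fVert_mem_of_domSet hS i f with h | h | ⟨l, h⟩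
    · simp [h]
    · exact absurd h hi
    · have := Finset.single_le_sum (f := fun l => if lVert (i, f, l) 0 ∈ S then 1 else 0)
        (fun _ _ => Nat.zero_le _) (Finset.mem_univ l)
      simp only [h, if_true] at this
      omega
  have hH (i : Fin m) : 2 * ∑ f, (if fVert i f ∈ S then 1 else 0) + 3 * (3 * t + 1) ≤
      3 * ((if hVert i ∈ S then 1 else 0) +
        ∑ f, ((if fVert i f ∈ S then 1 else 0) + ∑ l, ((if lVert (i, f, l) 0 ∈ S then 1 else 0) +
          (if lVert (i, f, l) 1 ∈ S then 1 else 0) + if lVert (i, f, l) 2 ∈ S then 1 else 0))) := by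
    have h0 := hL i 0
    have h1 := hL i 1
    have h2 := hL i 2
    simp only [Fin.sum_univ_three]
    by_cases hi : hVert i ∈ S
    · simp only [hi, if_true]
      omega
    · have h0' := hF i 0 hi
      have h1' := hF i 1 hi
      have h2' := hF i 2 hi
      simp only [hi, if_false]
      split_ifs at * <;> omega
  have := Finset.sum_le_sum fun i (_ : i ∈ Finset.univ) => hH i
  rw [← Finset.mul_sum, Finset.sum_add_distrib, ← Finset.mul_sum] at this
  rw [card_eq_sum S]
  simp only [Finset.sum_const, Finset.card_univ, Fintype.card_fin, smul_eq_mul,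
    mul_left_comm m 3] at this
  omega

/-- The vertices chosen in the copies of `L` by a set `T` of copies: the leaf if the copy lies
in `T` and the middle vertex otherwise. -/
noncomputable def middleOrLeaf (T : Finset (Fin m × Fin 3 × Fin t))
    (p : Fin m × Fin 3 × Fin t) : WVert m t :=
  open Classical in if p ∈ T then lVert p 2 else lVert p 1

theorem middleOrLeaf_injective (T : Finset (Fin m × Fin 3 × Fin t)) :
    Function.Injective (middleOrLeaf T) := by
  rintro ⟨i, f, l⟩ ⟨i', f', l'⟩ h
  simp only [middleOrLeaf] at h
  split_ifs at h <;> simp only [lVert] at h <;> cases h <;> rfl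

open Classical in
/-- The copies of `L` whose root is dominated by itself or from outside of the copy. -/
noncomputable def domCopies (Q : Finset (WVert m t)) : Finset (Fin m × Fin 3 × Fin t) :=
  {p | lVert p 0 ∈ Q ∨ fVert p.1 p.2.1 ∈ Q}

open Classical in
theorem card_domCopies_le (Q : Finset (WVert m t)) :
    (domCopies Q).card ≤ Q.card + t * ∑ i, ∑ f, (if fVert i f ∈ Q then 1 else 0) := by
  rw [domCopies, Finset.filter_or]
  refine (Finset.card_union_le _ _).trans (add_le_add ?_ ?_)
  · exact Finset.card_le_card_of_injOn (fun p => lVert p 0) (by intro p hp; simpa using hp)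
      (lVert_injective 0).injOn
  · simp only [Finset.card_filter, Fintype.sum_prod_type, Finset.mul_sum]
    refine (Finset.sum_congr rfl fun i _ => Finset.sum_congr rfl fun f _ => ?_).le
    by_cases h : fVert i f ∈ Q <;> simp [h]

open Classical in
theorem domCount_le {q N : ℕ} (hN : ∀ S, (Wtree m t).DomSet S → S.card = m * (3 * t) + q →
      ∑ i, ∑ f, (if fVert i f ∈ S then 1 else 0) ≤ N) :
    domCount (Wtree m t) (m * (3 * t) + q) ≤
      Fintype.card (WVert m t) ^ q * 2 ^ (q + t * N) := by
  let I : Finset (Σ _ : Finset (WVert m t), Finset (Fin m × Fin 3 × Fin t)) :=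
    Finset.sigma {Q ∈ Finset.powersetCard q Finset.univ |
      ∑ i, ∑ f, (if fVert i f ∈ Q then 1 else 0) ≤ N} fun Q => (domCopies Q).powerset
  have hI : I.card ≤ Fintype.card (WVert m t) ^ q * 2 ^ (q + t * N) := by
    rw [Finset.card_sigma]
    refine (Finset.sum_le_card_nsmul _ _ (2 ^ (q + t * N)) fun Q hQ => ?_).trans ?_
    · rw [Finset.mem_filter, Finset.mem_powersetCard] at hQ
      rw [Finset.card_powerset]
      refine Nat.pow_le_pow_right two_pos ((card_domCopies_le Q).trans ?_)
      rw [hQ.1.2]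
      gcongr
      exact hQ.2
    · rw [smul_eq_mul]
      refine Nat.mul_le_mul_right _ ((Finset.card_filter_le _ _).trans ?_)
      rw [Finset.card_powersetCard, Finset.card_univ]
      exact Nat.choose_le_pow _ _
  refine le_trans ?_ hI
  rw [domCount, Nat.card_eq_fintype_card, Fintype.card_subtype]
  let T (S : Finset (WVert m t)) : Finset (Fin m × Fin 3 × Fin t) := {p | lVert p 1 ∉ S}
  let M (S : Finset (WVert m t)) : Finset (WVert m t) :=
    Finset.univ.image (middleOrLeaf (T S))
  have hM (S) (hS : (Wtree m t).DomSet S) : M S ⊆ S := by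
    intro x hx
    obtain ⟨p, -, rfl⟩ := Finset.mem_image.mp hx
    have := lVert_one_or_two_mem_of_domSet hS p
    simp only [middleOrLeaf, T, Finset.mem_filter, Finset.mem_univ, true_and]
    grind
  have hf (S) (i : Fin m) (f : Fin 3) : fVert i f ∈ S \ M S ↔ fVert i f ∈ S := by
    simp only [Finset.mem_sdiff, and_iff_left_iff_imp, M, Finset.mem_image, middleOrLeaf]
    rintro - ⟨p, -, e⟩
    split_ifs at e <;> exact fVert_ne_lVert e.symm
  have hl (S) (p) : lVert p 0 ∈ S \ M S ↔ lVert p 0 ∈ S := by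
    simp only [Finset.mem_sdiff, and_iff_left_iff_imp, M, Finset.mem_image, middleOrLeaf]
    rintro - ⟨p, -, e⟩
    split_ifs at e <;> exact lVert_ne (by decide) e
  refine Finset.card_le_card_of_injOn (fun S => ⟨S \ M S, T S⟩) ?_ ?_
  · intro S hS
    obtain ⟨hS, hc⟩ := (Finset.mem_filter.mp hS).2
    refine Finset.mem_sigma.mpr ⟨Finset.mem_filter.mpr
      ⟨Finset.mem_powersetCard.mpr ⟨Finset.subset_univ _, ?_⟩, ?_⟩, ?_⟩
    · rw [Finset.card_sdiff_of_subset (hM S hS), hc,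
        Finset.card_image_of_injective _ (middleOrLeaf_injective _)]
      simp
    · simpa only [hf] using hN S hS hc
    · rw [Finset.mem_powerset]
      intro p hp
      have := lVert_zero_mem_of_domSet hS p
      simp only [domCopies, Finset.mem_filter, Finset.mem_univ, true_and, hf, hl, T] at hp ⊢
      grind
  · intro S hS S' hS' h
    have hS := (Finset.mem_filter.mp hS).2.1
    have hS' := (Finset.mem_filter.mp hS').2.1
    obtain ⟨hQ, hT⟩ : S \ M S = S' \ M S' ∧ T S = T S' := by simpa using h
    rw [← Finset.sdiff_union_of_subset (hM S hS), ← Finset.sdiff_union_of_subset (hM S' hS'), hQ]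
    simp only [M, hT]

/-- Membership in the dominating set that uses the roots of the copies of `F_t` in the first `J`
copies of `H_t`, the roots of the other copies of `H_t`, and the leaves of the copies of `L` in
`T`. -/
def witnessMem (J : ℕ) (T : Finset (Fin m × Fin 3 × Fin t)) : WVert m t → Prop
  | Sum.inl _ => False
  | Sum.inr (Sum.inr k) => k = 0
  | Sum.inr (Sum.inl (i, Sum.inl _)) => J ≤ i
  | Sum.inr (Sum.inl (i, Sum.inr (_, Sum.inl _))) => i < J
  | Sum.inr (Sum.inl (i, Sum.inr (f, Sum.inr (l, k)))) =>
    (k = 1 ∧ (i, f, l) ∉ T) ∨ (k = 2 ∧ (i, f, l) ∈ T)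

open Classical in
/-- The dominating set described by `witnessMem`. -/
noncomputable def witness (J : ℕ) (T : Finset (Fin m × Fin 3 × Fin t)) : Finset (WVert m t) :=
  {x | witnessMem J T x}

section witness

variable {J : ℕ} {T : Finset (Fin m × Fin 3 × Fin t)}

theorem mem_witness {x : WVert m t} : x ∈ witness J T ↔ witnessMem J T x := by
  simp [witness]

theorem root_mem_witness : root ∈ witness J T ↔ False :=
  mem_witness

theorem xVert_mem_witness {k : Fin 2} : xVert k ∈ witness J T ↔ k = 0 :=
  mem_witness

theorem hVert_mem_witness {i : Fin m} : hVert i ∈ witness J T ↔ J ≤ i :=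
  mem_witness

theorem fVert_mem_witness {i : Fin m} {f : Fin 3} : fVert i f ∈ witness J T ↔ i < J :=
  mem_witness

theorem lVert_mem_witness {p : Fin m × Fin 3 × Fin t} {k : Fin 3} :
    lVert p k ∈ witness J T ↔ (k = 1 ∧ p ∉ T) ∨ (k = 2 ∧ p ∈ T) :=
  mem_witness

theorem domSet_witness (hT : ∀ p ∈ T, p.1 < J) : (Wtree m t).DomSet (witness J T) := by
  intro x
  induction x using cases_vert with
  | root => exact Or.inr ⟨_, xVert_mem_witness.mpr rfl, adj_xVert_zero_root⟩
  | x0 => exact Or.inl (xVert_mem_witness.mpr rfl)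
  | x1 => exact Or.inr ⟨_, xVert_mem_witness.mpr rfl, adj_xVert_zero_one⟩
  | h i =>
    rcases le_or_gt J i with h | h
    · exact Or.inl (hVert_mem_witness.mpr h)
    · exact Or.inr ⟨_, fVert_mem_witness.mpr h, (adj_hVert_fVert i 0).symm⟩
  | f i f =>
    rcases le_or_gt J i with h | h
    · exact Or.inr ⟨_, hVert_mem_witness.mpr h, adj_hVert_fVert i f⟩
    · exact Or.inl (fVert_mem_witness.mpr h)
  | l0 p =>
    by_cases h : p ∈ T
    · exact Or.inr ⟨_, fVert_mem_witness.mpr (hT p h), adj_fVert_lVert p⟩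
    · exact Or.inr ⟨_, lVert_mem_witness.mpr (Or.inl ⟨rfl, h⟩),
        adj_lVert p (by simp [SimpleGraph.pathGraph_adj])⟩
  | l1 p =>
    by_cases h : p ∈ T
    · exact Or.inr ⟨_, lVert_mem_witness.mpr (Or.inr ⟨rfl, h⟩),
        adj_lVert p (by simp [SimpleGraph.pathGraph_adj])⟩
    · exact Or.inl (lVert_mem_witness.mpr (Or.inl ⟨rfl, h⟩))
  | l2 p =>
    by_cases h : p ∈ T
    · exact Or.inl (lVert_mem_witness.mpr (Or.inr ⟨rfl, h⟩))
    · exact Or.inr ⟨_, lVert_mem_witness.mpr (Or.inl ⟨rfl, h⟩),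
        adj_lVert p (by simp [SimpleGraph.pathGraph_adj])⟩

theorem card_witness (hJ : J ≤ m) : (witness J T).card = m * (3 * t + 1) + 1 + 2 * J := by
  classical
  have hL (i : Fin m) (f : Fin 3) (l : Fin t) :
      (if lVert (i, f, l) 0 ∈ witness J T then 1 else 0) +
        (if lVert (i, f, l) 1 ∈ witness J T then 1 else 0) +
          (if lVert (i, f, l) 2 ∈ witness J T then 1 else 0) = 1 := by
    by_cases h : (i, f, l) ∈ T <;> simp [lVert_mem_witness, h]
  have hH (i : Fin m) : (if hVert i ∈ witness J T then 1 else 0) +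
      ∑ f, ((if fVert i f ∈ witness J T then 1 else 0) + ∑ _l : Fin t, 1) =
        3 * t + 1 + 2 * if i < J then 1 else 0 := by
    simp only [hVert_mem_witness, fVert_mem_witness, Finset.sum_const, Finset.card_univ,
      Fintype.card_fin, smul_eq_mul]
    split_ifs <;> omega
  have hc : ∑ i : Fin m, (if i < J then 1 else 0) = J := by
    rw [← Finset.card_filter, Fin.card_filter_val_lt, min_eq_right hJ]
  rw [card_eq_sum]
  simp only [hL, hH]
  simp only [Finset.sum_add_distrib, ← Finset.mul_sum, hc, root_mem_witness,
    xVert_mem_witness]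
  simp
  ring

theorem witness_injective (J : ℕ) :
    Function.Injective (witness (m := m) (t := t) J) := by
  intro T T' h
  ext p
  simpa [lVert_mem_witness] using Finset.ext_iff.mp h (lVert p 2)

end witness

theorem domNumber_eq : domNumber (Wtree m t) = m * (3 * t + 1) + 1 := by
  refine le_antisymm (Nat.sInf_le ⟨witness 0 ∅, domSet_witness (by simp), ?_⟩) ?_
  · simp [card_witness]
  · refine le_csInf ⟨_, witness 0 ∅, domSet_witness (by simp), rfl⟩ ?_
    rintro _ ⟨S, hS, rfl⟩
    have := two_mul_sum_fVert_add_le hS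
    omega

theorem two_pow_le_domCount {J : ℕ} (hJ : J ≤ m) :
    2 ^ (3 * J * t) ≤ domCount (Wtree m t) (m * (3 * t + 1) + 1 + 2 * J) := by
  classical
  let A : Finset (Fin m × Fin 3 × Fin t) := 
    Finset.filter (fun i => i.val < J) Finset.univ ×ˢ Finset.univ
  have hA : A.card = 3 * J * t := by
    rw [Finset.card_product, Fin.card_filter_val_lt, min_eq_right hJ]
    simp
    ring
  rw [← hA, ← Finset.card_powerset, domCount, Nat.card_eq_fintype_card, Fintype.card_subtype]
  refine Finset.card_le_card_of_injOn (witness J) ?_ (witness_injective J).injOn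
  intro T hT
  rw [Finset.mem_coe, Finset.mem_powerset] at hT
  exact Finset.mem_filter.mpr ⟨Finset.mem_univ _,
    domSet_witness fun p hp => by simpa [A] using hT hp, card_witness hJ⟩

theorem domCount_odd_le {j : ℕ} :
    domCount (Wtree m t) (m * (3 * t + 1) + 1 + 2 * j + 1) ≤
      (2 * (m * (9 * t + 4) + 3)) ^ (m + 2 * j + 2) * 2 ^ (t * (3 * j + 1)) := by
  have h : m * (3 * t + 1) + 1 + 2 * j + 1 = m * (3 * t) + (m + 2 * j + 2) := by ring
  rw [h, mul_pow, ← card_vert, mul_comm (2 ^ _), mul_assoc, ← pow_add]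
  refine domCount_le fun S hS hc => ?_
  have := two_mul_sum_fVert_add_le hS
  rw [hc, ← h] at this
  omega

theorem eventually_pow_lt_two_pow (m k : ℕ) :
    ∀ᶠ t in Filter.atTop, (2 * (m * (9 * t + 4) + 3)) ^ k < 2 ^ t := by
  have hC : (0 : ℝ) < (26 * m + 6 : ℕ) ^ k := by positivity
  have h := (tendsto_pow_const_div_const_pow_of_one_lt k (one_lt_two (α := ℝ))).eventually_lt_const
    (inv_pos.mpr hC)
  filter_upwards [h, Filter.eventually_ge_atTop 1] with t ht ht1
  calc (2 * (m * (9 * t + 4) + 3)) ^ k ≤ ((26 * m + 6) * t) ^ k := by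
        refine Nat.pow_le_pow_left ?_ k
        nlinarith [Nat.mul_le_mul_left m ht1]
    _ < 2 ^ t := by
        rw [div_lt_iff₀ (by positivity), inv_mul_eq_div, lt_div_iff₀ hC, ← mul_pow, mul_comm] at ht
        exact_mod_cast ht

end Wtree

/-- For fixed `m ≥ 1` and all sufficiently large `t`, the dominating set sequence of
`W_{m,t}` satisfies `d_{γ+2j+1}^2 < d_{γ+2j} ⬝ d_{γ+2j+2}` for every `0 ≤ j ≤ m-1`,
where `γ` is the domination number of `W_{m,t}`. -/
theorem Wtree_log_concavity_failures (m : ℕ) (hm : 1 ≤ m) :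
    ∃ t0 : ℕ, ∀ t : ℕ, t0 ≤ t → ∀ j : ℕ, j < m →
      domCount (Wtree m t) (domNumber (Wtree m t) + 2 * j + 1) ^ 2 <
        domCount (Wtree m t) (domNumber (Wtree m t) + 2 * j) *
          domCount (Wtree m t) (domNumber (Wtree m t) + 2 * j + 2) := by
  obtain ⟨t0, ht0⟩ := Filter.eventually_atTop.mp (Wtree.eventually_pow_lt_two_pow m (6 * m))
  refine ⟨t0, fun t ht j hj => ?_⟩
  rw [Wtree.domNumber_eq]
  set B := 2 * (m * (9 * t + 4) + 3)
  have hB : (B ^ (m + 2 * j + 2)) ^ 2 < 2 ^ t := by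
    rw [← pow_mul]
    exact (Nat.pow_le_pow_right (by omega) (by omega)).trans_lt (ht0 t ht)
  calc _ ≤ (B ^ (m + 2 * j + 2) * 2 ^ (t * (3 * j + 1))) ^ 2 :=
        Nat.pow_le_pow_left Wtree.domCount_odd_le 2
    _ = (B ^ (m + 2 * j + 2)) ^ 2 * 2 ^ (t * (6 * j + 2)) := by
        rw [mul_pow, ← pow_mul 2]
        ring_nf
    _ < 2 ^ t * 2 ^ (t * (6 * j + 2)) := by gcongr
    _ = 2 ^ (3 * j * t) * 2 ^ (3 * (j + 1) * t) := by
        rw [← pow_add, ← pow_add]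
        ring_nf
    _ ≤ _ := Nat.mul_le_mul (Wtree.two_pow_le_domCount hj.le) (Wtree.two_pow_le_domCount hj)
end

section
/- Let S be a finite rooted tree whose root has child-subtrees S_1,…,S_d (the subtrees rooted at the children of the root). Then the rooted domination state polynomials satisfy the recurrences: 𝒜_S(x) = x·∏_{i=1}^d (𝒜_{S_i}(x)+ℬ_{S_i}(x)+𝒞_{S_i}(x)), ℬ_S(x) = ∏_{i=1}^d (𝒜_{S_i}(x)+ℬ_{S_i}(x)) − ∏_{i=1}^d ℬ_{S_i}(x), and 𝒞_S(x) = ∏_{i=1}^d ℬ_{S_i}(x). -/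
open Polynomial

/-- `𝒜_S(x)`: generating polynomial (by cardinality) of subsets `S'` containing the root `ρ`
such that every vertex is in `S'` or adjacent to a member of `S'`. -/
noncomputable def stateA {V : Type*} [Fintype V] (G : SimpleGraph V) (ρ : V) :
    Polynomial ℤ :=
  ∑ j ∈ Finset.range (Fintype.card V + 1),
    (Nat.card {S : Finset V // S.card = j ∧ ρ ∈ S ∧
      ∀ v, v ∈ S ∨ ∃ u ∈ S, G.Adj u v} : Polynomial ℤ) * Polynomial.X ^ j

/-- `ℬ_S(x)`: generating polynomial of subsets `S'` with `ρ ∉ S'`, `ρ` adjacent to a member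
of `S'`, and every vertex other than `ρ` in `S'` or adjacent to a member of `S'`. -/
noncomputable def stateB {V : Type*} [Fintype V] (G : SimpleGraph V) (ρ : V) :
    Polynomial ℤ :=
  ∑ j ∈ Finset.range (Fintype.card V + 1),
    (Nat.card {S : Finset V // S.card = j ∧ ρ ∉ S ∧ (∃ u ∈ S, G.Adj u ρ) ∧
      ∀ v, v ≠ ρ → (v ∈ S ∨ ∃ u ∈ S, G.Adj u v)} : Polynomial ℤ) * Polynomial.X ^ j

/-- `𝒞_S(x)`: generating polynomial of subsets `S'` with `ρ ∉ S'`, `ρ` not adjacent to any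
member of `S'`, and every vertex other than `ρ` in `S'` or adjacent to a member of `S'`. -/
noncomputable def stateC {V : Type*} [Fintype V] (G : SimpleGraph V) (ρ : V) :
    Polynomial ℤ :=
  ∑ j ∈ Finset.range (Fintype.card V + 1),
    (Nat.card {S : Finset V // S.card = j ∧ ρ ∉ S ∧ (¬ ∃ u ∈ S, G.Adj u ρ) ∧
      ∀ v, v ≠ ρ → (v ∈ S ∨ ∃ u ∈ S, G.Adj u v)} : Polynomial ℤ) * Polynomial.X ^ j

/-- Vertices of the rooted tree obtained from rooted trees `S_1, …, S_d` by attaching a new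
root to the root of each `S_i`. -/
def JoinVert {d : ℕ} (V : Fin d → Type) : Type := Unit ⊕ (Σ i : Fin d, V i)

instance {d : ℕ} (V : Fin d → Type) [∀ i, Fintype (V i)] : Fintype (JoinVert V) := by
  unfold JoinVert; infer_instance

/-- Base edge relation of the join: the new root is adjacent to each root `ρ i`, and each
child subtree keeps its own edges. -/
def joinRel {d : ℕ} {V : Fin d → Type} (G : ∀ i, SimpleGraph (V i)) (ρ : ∀ i, V i)
    (x y : JoinVert V) : Prop :=
  (∃ i : Fin d, x = Sum.inl () ∧ y = Sum.inr ⟨i, ρ i⟩) ∨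
  (∃ (i : Fin d) (a b : V i), (G i).Adj a b ∧ x = Sum.inr ⟨i, a⟩ ∧ y = Sum.inr ⟨i, b⟩)

/-- The rooted tree with root `Sum.inl ()` whose child-subtrees are `S_1, …, S_d`. -/
def joinGraph {d : ℕ} {V : Fin d → Type} (G : ∀ i, SimpleGraph (V i)) (ρ : ∀ i, V i) :
    SimpleGraph (JoinVert V) :=
  SimpleGraph.fromRel (joinRel G ρ)

/-- `v` belongs to `S` or is adjacent to a member of `S`. -/
def DominatedBy {V : Type*} (G : SimpleGraph V) (S : Finset V) (v : V) : Prop :=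
  v ∈ S ∨ ∃ u ∈ S, G.Adj u v

/-- Every vertex is dominated by `S`. -/
def IsDominating {V : Type*} (G : SimpleGraph V) (S : Finset V) : Prop :=
  ∀ v, DominatedBy G S v

/-- Every vertex other than `ρ` is dominated by `S`. -/
def IsDominatingOff {V : Type*} (G : SimpleGraph V) (ρ : V) (S : Finset V) : Prop :=
  ∀ v, v ≠ ρ → DominatedBy G S v

/-- The sets counted by `stateA`. -/
def IsStateA {V : Type*} (G : SimpleGraph V) (ρ : V) (S : Finset V) : Prop :=
  ρ ∈ S ∧ IsDominating G S

/-- The sets counted by `stateB`. -/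
def IsStateB {V : Type*} (G : SimpleGraph V) (ρ : V) (S : Finset V) : Prop :=
  ρ ∉ S ∧ (∃ u ∈ S, G.Adj u ρ) ∧ IsDominatingOff G ρ S

/-- The sets counted by `stateC`. -/
def IsStateC {V : Type*} (G : SimpleGraph V) (ρ : V) (S : Finset V) : Prop :=
  ρ ∉ S ∧ (¬ ∃ u ∈ S, G.Adj u ρ) ∧ IsDominatingOff G ρ S

section States

variable {V : Type*} (G : SimpleGraph V) (ρ : V) (S : Finset V)

theorem isStateA_or_isStateB_iff :
    IsStateA G ρ S ∨ IsStateB G ρ S ↔ IsDominating G S := by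
  refine ⟨?_, fun h => ?_⟩
  · rintro (h | ⟨-, hadj, h⟩) v
    · exact h.2 v
    · obtain rfl | hv := eq_or_ne v ρ
      · exact Or.inr hadj
      · exact h v hv
  · by_cases hρ : ρ ∈ S
    · exact Or.inl ⟨hρ, h⟩
    · exact Or.inr ⟨hρ, (h ρ).resolve_left hρ, fun v _ => h v⟩

theorem isState_iff :
    (IsStateA G ρ S ∨ IsStateB G ρ S) ∨ IsStateC G ρ S ↔ IsDominatingOff G ρ S := by
  rw [isStateA_or_isStateB_iff]
  refine ⟨?_, fun h => ?_⟩
  · rintro (h | h) v hv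
    exacts [h v, h.2.2 v hv]
  · by_cases hρ : DominatedBy G S ρ
    · refine Or.inl fun v => ?_
      obtain rfl | hv := eq_or_ne v ρ
      exacts [hρ, h v hv]
    · exact Or.inr ⟨fun hm => hρ (Or.inl hm), fun hm => hρ (Or.inr hm), h⟩

end States

section GeneratingFunctions

open Classical Finset

theorem sum_natCard_mul_X_pow {V : Type*} [Fintype V] (P : Finset V → Prop) :
    ∑ j ∈ range (Fintype.card V + 1),
      (Nat.card {S : Finset V // #S = j ∧ P S} : ℤ[X]) * X ^ j =
    ∑ S with P S, (X : ℤ[X]) ^ #S := by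
  rw [← sum_fiberwise_of_maps_to (g := card) (t := range (Fintype.card V + 1))
    (fun S _ => mem_range.2 (Nat.lt_succ_of_le (card_le_univ S)))]
  refine sum_congr rfl fun j _ => ?_
  rw [sum_congr rfl (g := fun _ => (X : ℤ[X]) ^ j)
    fun S hS => by rw [(mem_filter.1 hS).2], sum_const, nsmul_eq_mul,
    Nat.card_eq_fintype_card, Fintype.card_subtype, filter_filter]
  simp only [and_comm]

variable {V : Type*} [Fintype V] (G : SimpleGraph V) (ρ : V)

theorem stateA_eq_sum : stateA G ρ = ∑ S with IsStateA G ρ S, X ^ #S :=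
  sum_natCard_mul_X_pow _

theorem stateB_eq_sum : stateB G ρ = ∑ S with IsStateB G ρ S, X ^ #S :=
  sum_natCard_mul_X_pow _

theorem stateC_eq_sum : stateC G ρ = ∑ S with IsStateC G ρ S, X ^ #S :=
  sum_natCard_mul_X_pow _

theorem stateA_add_stateB_eq_sum :
    stateA G ρ + stateB G ρ = ∑ S with IsDominating G S, X ^ #S := by
  simp only [← isStateA_or_isStateB_iff G ρ]
  rw [stateA_eq_sum, stateB_eq_sum, filter_or, sum_union]
  exact disjoint_filter.2 fun S _ hA hB => hB.1 hA.1

theorem stateA_add_stateB_add_stateC_eq_sum :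
    stateA G ρ + stateB G ρ + stateC G ρ =
      ∑ S with IsDominatingOff G ρ S, X ^ #S := by
  simp only [← isState_iff G ρ]
  rw [stateA_add_stateB_eq_sum, stateC_eq_sum, filter_or, sum_union]
  · simp only [← isStateA_or_isStateB_iff G ρ]
  · refine disjoint_filter.2 fun S _ hAB hC => ?_
    rcases hAB with hA | hB
    exacts [hC.1 hA.1, hC.2.1 hB.2.1]

theorem prod_sum_X_pow_card {ι : Type*} [Fintype ι] [DecidableEq ι] {W : ι → Type*}
    [∀ i, Fintype (W i)] (P : ∀ i, Finset (W i) → Prop) :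
    ∏ i, ∑ S with P i S, (X : ℤ[X]) ^ #S =
      ∑ T : (∀ i, Finset (W i)) with ∀ i, P i (T i), X ^ ∑ i, #(T i) := by
  rw [prod_univ_sum]
  refine sum_congr ?_ fun T _ => prod_pow_eq_pow_sum _ _ _
  ext T
  simp [Fintype.mem_piFinset]

end GeneratingFunctions

section Join

variable {d : ℕ} {V : Fin d → Type}

/-- The new root of the join. -/
def JoinVert.root : JoinVert V := Sum.inl ()

/-- The vertex `v` of the `i`-th child-subtree, as a vertex of the join. -/
def JoinVert.node (i : Fin d) (v : V i) : JoinVert V := Sum.inr ⟨i, v⟩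

open JoinVert

theorem JoinVert.eq_root_or_eq_node (x : JoinVert V) : x = root ∨ ∃ i v, x = node i v :=
  match x with
  | Sum.inl () => Or.inl rfl
  | Sum.inr ⟨i, v⟩ => Or.inr ⟨i, v, rfl⟩

theorem JoinVert.root_ne_node (i : Fin d) (v : V i) : (root : JoinVert V) ≠ node i v :=
  Sum.inl_ne_inr

theorem JoinVert.node_injective {i j : Fin d} {u : V i} {v : V j}
    (h : (node i u : JoinVert V) = node j v) : (⟨i, u⟩ : Σ i, V i) = ⟨j, v⟩ :=
  Sum.inr_injective h

/-- The subset of the join with trace `T i` on the `i`-th child-subtree, containing the new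
root exactly when `b` is true. -/
def joinFinset (b : Bool) (T : ∀ i, Finset (V i)) : Finset (JoinVert V) :=
  Finset.disjSum (if b then {()} else ∅) (Finset.univ.sigma T)

theorem root_mem_joinFinset (b : Bool) (T : ∀ i, Finset (V i)) :
    root ∈ joinFinset b T ↔ b :=
  Finset.inl_mem_disjSum.trans (by cases b <;> simp)

theorem node_mem_joinFinset (b : Bool) (T : ∀ i, Finset (V i)) (i : Fin d) (v : V i) :
    node i v ∈ joinFinset b T ↔ v ∈ T i :=
  Finset.inr_mem_disjSum.trans (by simp)

theorem card_joinFinset (b : Bool) (T : ∀ i, Finset (V i)) :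
    (joinFinset b T).card = (if b then 1 else 0) + ∑ i, (T i).card :=
  (Finset.card_disjSum _ _).trans (by cases b <;> simp)

theorem joinFinset_bijective [∀ i, Fintype (V i)] :
    Function.Bijective fun p : Bool × ∀ i, Finset (V i) => joinFinset p.1 p.2 := by
  classical
  refine ⟨?_, fun S => ?_⟩
  · rintro ⟨b, T⟩ ⟨b', T'⟩ h
    have h' := Finset.ext_iff.1 h
    refine Prod.ext ?_ (funext fun i => Finset.ext fun v => ?_)
    · have hroot := h' root
      rwa [root_mem_joinFinset, root_mem_joinFinset, ← Bool.eq_iff_iff] at hroot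
    · simpa [node_mem_joinFinset] using h' (node i v)
  · refine ⟨(decide (root ∈ S), fun i => Finset.univ.filter fun v => node i v ∈ S),
      Finset.ext fun x => ?_⟩
    obtain rfl | ⟨i, v, rfl⟩ := x.eq_root_or_eq_node
    · simp [root_mem_joinFinset]
    · simp [node_mem_joinFinset]

open Classical in
theorem sum_finset_joinVert [∀ i, Fintype (V i)] (P : Finset (JoinVert V) → Prop) :
    ∑ S with P S, (X : ℤ[X]) ^ S.card =
      X * (∑ T with P (joinFinset true T), X ^ ∑ i, (T i).card) +
        ∑ T with P (joinFinset false T), X ^ ∑ i, (T i).card := by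
  rw [Finset.sum_filter, ← joinFinset_bijective.sum_comp, Fintype.sum_prod_type,
    Fintype.sum_bool]
  simp [card_joinFinset, Finset.mul_sum, Finset.sum_filter, pow_add]

variable (G : ∀ i, SimpleGraph (V i)) (ρ : ∀ i, V i)

theorem joinGraph_adj_root_node (i : Fin d) (v : V i) :
    (joinGraph G ρ).Adj root (node i v) ↔ v = ρ i := by
  refine (SimpleGraph.fromRel_adj _ _ _).trans ⟨?_, ?_⟩
  · rintro ⟨-, (⟨j, -, h⟩ | ⟨j, a, b, -, h, -⟩) | (⟨j, h, -⟩ | ⟨j, a, b, -, -, h⟩)⟩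
    · cases node_injective h
      rfl
    · exact absurd h (root_ne_node j a)
    · exact absurd h.symm (root_ne_node i v)
    · exact absurd h (root_ne_node j b)
  · rintro rfl
    exact ⟨root_ne_node _ _, Or.inl (Or.inl ⟨i, rfl, rfl⟩)⟩

theorem joinGraph_adj_node_node (i j : Fin d) (u : V i) (v : V j) :
    (joinGraph G ρ).Adj (node i u) (node j v) ↔ ∃ h : i = j, (G j).Adj (h ▸ u) v := by
  refine (SimpleGraph.fromRel_adj _ _ _).trans ⟨?_, ?_⟩
  · rintro ⟨-, (⟨k, h, -⟩ | ⟨k, a, b, hab, h, h'⟩) | (⟨k, h, -⟩ | ⟨k, a, b, hab, h, h'⟩)⟩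
    · exact absurd h.symm (root_ne_node i u)
    · cases node_injective h
      cases node_injective h'
      exact ⟨rfl, hab⟩
    · exact absurd h.symm (root_ne_node j v)
    · cases node_injective h
      cases node_injective h'
      exact ⟨rfl, hab.symm⟩
  · rintro ⟨rfl, h⟩
    refine ⟨fun e => ?_, Or.inl (Or.inr ⟨i, u, v, h, rfl, rfl⟩)⟩
    cases node_injective e
    exact h.ne rfl

theorem exists_mem_joinFinset_adj_root (b : Bool) (T : ∀ i, Finset (V i)) :
    (∃ u ∈ joinFinset b T, (joinGraph G ρ).Adj u root) ↔ ∃ i, ρ i ∈ T i := by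
  constructor
  · rintro ⟨x, hx, h⟩
    obtain rfl | ⟨i, u, rfl⟩ := x.eq_root_or_eq_node
    · exact absurd rfl h.ne
    · obtain rfl := (joinGraph_adj_root_node G ρ i u).1 h.symm
      exact ⟨i, (node_mem_joinFinset b T i _).1 hx⟩
  · rintro ⟨i, hi⟩
    exact ⟨node i (ρ i), (node_mem_joinFinset b T i _).2 hi,
      ((joinGraph_adj_root_node G ρ i _).2 rfl).symm⟩

theorem dominatedBy_joinFinset_node (b : Bool) (T : ∀ i, Finset (V i)) (i : Fin d) (v : V i) :
    DominatedBy (joinGraph G ρ) (joinFinset b T) (node i v) ↔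
      (b ∧ v = ρ i) ∨ DominatedBy (G i) (T i) v := by
  constructor
  · rintro (hv | ⟨x, hx, h⟩)
    · exact Or.inr (Or.inl ((node_mem_joinFinset b T i v).1 hv))
    obtain rfl | ⟨j, u, rfl⟩ := x.eq_root_or_eq_node
    · exact Or.inl ⟨(root_mem_joinFinset b T).1 hx, (joinGraph_adj_root_node G ρ i v).1 h⟩
    · obtain ⟨rfl, h⟩ := (joinGraph_adj_node_node G ρ j i u v).1 h
      exact Or.inr (Or.inr ⟨u, (node_mem_joinFinset b T j u).1 hx, h⟩)
  · rintro (⟨hb, hv⟩ | hv | ⟨u, hu, h⟩)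
    · exact Or.inr ⟨root, (root_mem_joinFinset b T).2 hb,
        (joinGraph_adj_root_node G ρ i v).2 hv⟩
    · exact Or.inl ((node_mem_joinFinset b T i v).2 hv)
    · exact Or.inr ⟨node i u, (node_mem_joinFinset b T i u).2 hu,
        (joinGraph_adj_node_node G ρ i i u v).2 ⟨rfl, h⟩⟩

theorem isDominatingOff_root_joinFinset (b : Bool) (T : ∀ i, Finset (V i)) :
    IsDominatingOff (joinGraph G ρ) root (joinFinset b T) ↔
      ∀ i v, (b ∧ v = ρ i) ∨ DominatedBy (G i) (T i) v := by
  refine ⟨fun h i v => ?_, fun h x hx => ?_⟩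
  · exact (dominatedBy_joinFinset_node G ρ b T i v).1 (h _ (root_ne_node i v).symm)
  · obtain rfl | ⟨i, v, rfl⟩ := x.eq_root_or_eq_node
    · exact absurd rfl hx
    · exact (dominatedBy_joinFinset_node G ρ b T i v).2 (h i v)

theorem isDominatingOff_root_joinFinset_true (T : ∀ i, Finset (V i)) :
    IsDominatingOff (joinGraph G ρ) root (joinFinset true T) ↔
      ∀ i, IsDominatingOff (G i) (ρ i) (T i) := by
  rw [isDominatingOff_root_joinFinset]
  simp only [true_and, or_iff_not_imp_left, IsDominatingOff, ne_eq]

theorem isDominatingOff_root_joinFinset_false (T : ∀ i, Finset (V i)) :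
    IsDominatingOff (joinGraph G ρ) root (joinFinset false T) ↔
      ∀ i, IsDominating (G i) (T i) := by
  simp only [isDominatingOff_root_joinFinset, Bool.false_eq_true, false_and, false_or,
    IsDominating]

theorem isStateA_joinFinset_true (T : ∀ i, Finset (V i)) :
    IsStateA (joinGraph G ρ) root (joinFinset true T) ↔
      ∀ i, IsDominatingOff (G i) (ρ i) (T i) := by
  have hroot : root ∈ joinFinset true T := (root_mem_joinFinset true T).2 rfl
  rw [← isDominatingOff_root_joinFinset_true]
  refine ⟨fun h v _ => h.2 v, fun h => ⟨hroot, fun v => ?_⟩⟩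
  by_cases hv : v = root
  · exact hv ▸ Or.inl hroot
  · exact h v hv

theorem not_isStateA_joinFinset_false (T : ∀ i, Finset (V i)) :
    ¬ IsStateA (joinGraph G ρ) root (joinFinset false T) :=
  fun h => by simpa [root_mem_joinFinset] using h.1

theorem not_isStateB_joinFinset_true (T : ∀ i, Finset (V i)) :
    ¬ IsStateB (joinGraph G ρ) root (joinFinset true T) :=
  fun h => by simpa [root_mem_joinFinset] using h.1

theorem not_isStateC_joinFinset_true (T : ∀ i, Finset (V i)) :
    ¬ IsStateC (joinGraph G ρ) root (joinFinset true T) :=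
  fun h => by simpa [root_mem_joinFinset] using h.1

theorem isStateC_joinFinset_false (T : ∀ i, Finset (V i)) :
    IsStateC (joinGraph G ρ) root (joinFinset false T) ↔
      ∀ i, IsStateB (G i) (ρ i) (T i) := by
  rw [IsStateC, root_mem_joinFinset, exists_mem_joinFinset_adj_root,
    isDominatingOff_root_joinFinset_false]
  simp only [Bool.false_eq_true, not_false_eq_true, true_and, not_exists, ← forall_and]
  refine forall_congr' fun i => ?_
  rw [← isStateA_or_isStateB_iff (G i) (ρ i)]
  exact ⟨fun h => h.2.resolve_left fun hA => h.1 hA.1, fun h => ⟨h.1, Or.inr h⟩⟩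

theorem isStateB_joinFinset_false (T : ∀ i, Finset (V i)) :
    IsStateB (joinGraph G ρ) root (joinFinset false T) ↔
      (∀ i, IsDominating (G i) (T i)) ∧ ¬ ∀ i, IsStateB (G i) (ρ i) (T i) := by
  rw [IsStateB, root_mem_joinFinset, exists_mem_joinFinset_adj_root,
    isDominatingOff_root_joinFinset_false]
  simp only [Bool.false_eq_true, not_false_eq_true, true_and]
  rw [and_comm]
  refine and_congr_right fun h => ?_
  rw [not_forall]
  refine exists_congr fun i => ⟨fun hi hB => hB.1 hi, fun hB => ?_⟩
  exact (((isStateA_or_isStateB_iff (G i) (ρ i) (T i)).2 (h i)).resolve_right hB).1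

end Join

/-- The recurrences for the rooted domination state polynomials of a rooted tree whose root
has child-subtrees `S_1, …, S_d`:
`𝒜 = x ∏ (𝒜ᵢ + ℬᵢ + 𝒞ᵢ)`, `ℬ = ∏ (𝒜ᵢ + ℬᵢ) - ∏ ℬᵢ` and `𝒞 = ∏ ℬᵢ`. -/
theorem state_recurrences {d : ℕ} (V : Fin d → Type) [∀ i, Fintype (V i)]
    (G : ∀ i, SimpleGraph (V i)) (ρ : ∀ i, V i)
    (hconn : ∀ i, (G i).Connected) (hacyc : ∀ i, (G i).IsAcyclic) :
    stateA (joinGraph G ρ) (Sum.inl ()) =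
        X * ∏ i : Fin d, (stateA (G i) (ρ i) + stateB (G i) (ρ i) + stateC (G i) (ρ i)) ∧
    stateB (joinGraph G ρ) (Sum.inl ()) =
        (∏ i : Fin d, (stateA (G i) (ρ i) + stateB (G i) (ρ i))) -
          ∏ i : Fin d, stateB (G i) (ρ i) ∧
    stateC (joinGraph G ρ) (Sum.inl ()) = ∏ i : Fin d, stateB (G i) (ρ i) := by
  classical
  change stateA (joinGraph G ρ) JoinVert.root = _ ∧ stateB (joinGraph G ρ) JoinVert.root = _ ∧
    stateC (joinGraph G ρ) JoinVert.root = _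
  refine ⟨?_, ?_, ?_⟩
  · simp only [stateA_add_stateB_add_stateC_eq_sum]
    rw [stateA_eq_sum, sum_finset_joinVert, prod_sum_X_pow_card]
    simp only [isStateA_joinFinset_true, not_isStateA_joinFinset_false, Finset.filter_false,
      Finset.sum_empty, add_zero]
    congr!
  · simp only [stateA_add_stateB_eq_sum]
    simp only [stateB_eq_sum]
    rw [sum_finset_joinVert, prod_sum_X_pow_card, prod_sum_X_pow_card, eq_sub_iff_add_eq]
    simp only [isStateB_joinFinset_false, not_isStateB_joinFinset_true, Finset.filter_false,
      Finset.sum_empty, mul_zero, zero_add, Finset.sum_filter]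
    rw [← Finset.sum_add_distrib]
    refine Finset.sum_congr rfl fun T _ => ?_
    have hB : (∀ i, IsStateB (G i) (ρ i) (T i)) → ∀ i, IsDominating (G i) (T i) :=
      fun h i => (isStateA_or_isStateB_iff (G i) (ρ i) (T i)).1 (Or.inr (h i))
    split_ifs <;> first | tauto | simp
  · simp only [stateB_eq_sum]
    rw [stateC_eq_sum, sum_finset_joinVert, prod_sum_X_pow_card]
    simp only [isStateC_joinFinset_false, not_isStateC_joinFinset_true, Finset.filter_false,
      Finset.sum_empty, mul_zero, zero_add]
    congr!
end

section
/- Fix integers m ≥ 1 and r with 0 ≤ r ≤ 2m, and set v_r := r + ⌊r/2⌋. Define e_r(m,t) := d_{γ(W_{m,t}) + r}(W_{m,t}), where γ(W_{m,t}) = m(3t+1)+1 is the domination number of W_{m,t}. Then there exist K ≥ 0, constants c, C > 0 and t_0 (possibly depending on m and r) such that for all integers t ≥ t_0: c · t^{−K} · 2^{v_r t} ≤ e_r(m,t) ≤ C · t^K · 2^{v_r t}. -/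
/-- `e_r(m,t) := d_{γ(W_{m,t})+r}(W_{m,t})`, the number of dominating sets of `W_{m,t}`
of cardinality `γ(W_{m,t}) + r`. -/
noncomputable def eCoeff (m t r : ℕ) : ℕ :=
  domCount (Wtree m t) (domNumber (Wtree m t) + r)

section Adjacency

variable {m t : ℕ}

theorem Ftree_adj_iff (x y : Unit ⊕ (Fin t × Fin 3)) :
    (Ftree t).Adj x y ↔ (x = Sum.inl () ∧ ∃ ℓ, y = Sum.inr (ℓ, 0)) ∨
      (y = Sum.inl () ∧ ∃ ℓ, x = Sum.inr (ℓ, 0)) ∨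
      ∃ ℓ a b, (SimpleGraph.pathGraph 3).Adj a b ∧ x = Sum.inr (ℓ, a) ∧ y = Sum.inr (ℓ, b) := by
  have h : (Ftree t).Adj x y ↔ x ≠ y ∧
      (((∃ ℓ : Fin t, x = Sum.inl () ∧ y = Sum.inr (ℓ, 0)) ∨
        (∃ (ℓ : Fin t) (a b : Fin 3), (SimpleGraph.pathGraph 3).Adj a b ∧
          x = Sum.inr (ℓ, a) ∧ y = Sum.inr (ℓ, b))) ∨
      ((∃ ℓ : Fin t, y = Sum.inl () ∧ x = Sum.inr (ℓ, 0)) ∨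
        (∃ (ℓ : Fin t) (a b : Fin 3), (SimpleGraph.pathGraph 3).Adj a b ∧
          y = Sum.inr (ℓ, a) ∧ x = Sum.inr (ℓ, b)))) := Iff.rfl
  rw [h]
  rcases x with _ | ⟨j, k⟩ <;> rcases y with _ | ⟨j', k'⟩ <;> simp
  constructor
  · rintro ⟨-, ⟨ha, rfl⟩ | ⟨ha, rfl⟩⟩
    exacts [⟨ha, rfl⟩, ⟨ha.symm, rfl⟩]
  · rintro ⟨ha, rfl⟩
    exact ⟨fun _ => ha.ne, Or.inl ⟨ha, rfl⟩⟩

theorem Htree_adj_iff (x y : Unit ⊕ (Fin 3 × FVert t)) :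
    (Htree t).Adj x y ↔ (x = Sum.inl () ∧ ∃ b, y = Sum.inr (b, Sum.inl ())) ∨
      (y = Sum.inl () ∧ ∃ b, x = Sum.inr (b, Sum.inl ())) ∨
      ∃ b p q, (Ftree t).Adj p q ∧ x = Sum.inr (b, p) ∧ y = Sum.inr (b, q) := by
  have h : (Htree t).Adj x y ↔ x ≠ y ∧
      (((∃ b : Fin 3, x = Sum.inl () ∧ y = Sum.inr (b, Sum.inl ())) ∨
        (∃ (b : Fin 3) (p q : FVert t), (Ftree t).Adj p q ∧
          x = Sum.inr (b, p) ∧ y = Sum.inr (b, q))) ∨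
      ((∃ b : Fin 3, y = Sum.inl () ∧ x = Sum.inr (b, Sum.inl ())) ∨
        (∃ (b : Fin 3) (p q : FVert t), (Ftree t).Adj p q ∧
          y = Sum.inr (b, p) ∧ x = Sum.inr (b, q)))) := Iff.rfl
  rw [h]
  rcases x with _ | ⟨j, k⟩ <;> rcases y with _ | ⟨j', k'⟩ <;> simp
  constructor
  · rintro ⟨-, ⟨ha, rfl⟩ | ⟨ha, rfl⟩⟩
    exacts [⟨ha, rfl⟩, ⟨ha.symm, rfl⟩]
  · rintro ⟨ha, rfl⟩
    exact ⟨fun _ => ha.ne, Or.inl ⟨ha, rfl⟩⟩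

theorem Wtree_adj_iff (x y : Unit ⊕ ((Fin m × HVert t) ⊕ Fin 2)) :
    (Wtree m t).Adj x y ↔
      (x = Sum.inl () ∧ ∃ i, y = Sum.inr (Sum.inl (i, Sum.inl ()))) ∨
      (y = Sum.inl () ∧ ∃ i, x = Sum.inr (Sum.inl (i, Sum.inl ()))) ∨
      (x = Sum.inl () ∧ y = Sum.inr (Sum.inr 0)) ∨
      (y = Sum.inl () ∧ x = Sum.inr (Sum.inr 0)) ∨
      (∃ i p q, (Htree t).Adj p q ∧
        x = Sum.inr (Sum.inl (i, p)) ∧ y = Sum.inr (Sum.inl (i, q))) ∨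
      (x = Sum.inr (Sum.inr 0) ∧ y = Sum.inr (Sum.inr 1)) ∨
      (y = Sum.inr (Sum.inr 0) ∧ x = Sum.inr (Sum.inr 1)) := by
  have h : (Wtree m t).Adj x y ↔ x ≠ y ∧
      (((∃ i : Fin m, x = Sum.inl () ∧ y = Sum.inr (Sum.inl (i, Sum.inl ()))) ∨
        (x = Sum.inl () ∧ y = Sum.inr (Sum.inr 0)) ∨
        (∃ (i : Fin m) (p q : HVert t), (Htree t).Adj p q ∧
          x = Sum.inr (Sum.inl (i, p)) ∧ y = Sum.inr (Sum.inl (i, q))) ∨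
        (x = Sum.inr (Sum.inr 0) ∧ y = Sum.inr (Sum.inr 1))) ∨
      ((∃ i : Fin m, y = Sum.inl () ∧ x = Sum.inr (Sum.inl (i, Sum.inl ()))) ∨
        (y = Sum.inl () ∧ x = Sum.inr (Sum.inr 0)) ∨
        (∃ (i : Fin m) (p q : HVert t), (Htree t).Adj p q ∧
          y = Sum.inr (Sum.inl (i, p)) ∧ x = Sum.inr (Sum.inl (i, q))) ∨
        (y = Sum.inr (Sum.inr 0) ∧ x = Sum.inr (Sum.inr 1)))) := Iff.rfl
  rw [h]
  rcases x with _ | ⟨i, p⟩ | k <;> rcases y with _ | ⟨i', p'⟩ | k' <;> simp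
  · constructor
    · rintro ⟨-, ⟨ha, rfl⟩ | ⟨ha, rfl⟩⟩
      exacts [⟨ha, rfl⟩, ⟨ha.symm, rfl⟩]
    · rintro ⟨ha, rfl⟩
      exact ⟨fun _ => ha.ne, Or.inl ⟨ha, rfl⟩⟩
  · omega

end Adjacency

namespace WVert

variable {m t : ℕ}

/-- The root of `W_{m,t}`. -/
def root : WVert m t := Sum.inl ()

/-- The root of the `i`-th copy of `H_t`. -/
def hub (i : Fin m) : WVert m t := Sum.inr (Sum.inl (i, Sum.inl ()))

/-- The root of the copy of `F_t` indexed by `q`. -/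
def center (q : Fin m × Fin 3) : WVert m t :=
  Sum.inr (Sum.inl (q.1, Sum.inr (q.2, Sum.inl ())))

/-- The `k`-th vertex of the copy of `L` indexed by `p`. -/
def leg (p : (Fin m × Fin 3) × Fin t) (k : Fin 3) : WVert m t :=
  Sum.inr (Sum.inl (p.1.1, Sum.inr (p.1.2, Sum.inr (p.2, k))))

/-- The vertices of the copy of `X`. -/
def tail (k : Fin 2) : WVert m t := Sum.inr (Sum.inr k)

theorem forall_iff {P : WVert m t → Prop} :
    (∀ v, P v) ↔ P root ∧ (∀ i, P (hub i)) ∧ (∀ q, P (center q)) ∧ (∀ p k, P (leg p k)) ∧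
      ∀ k, P (tail k) := by
  refine ⟨fun h => ⟨h _, fun _ => h _, fun _ => h _, fun _ _ => h _, fun _ => h _⟩, ?_⟩
  rintro ⟨hr, hh, hc, hl, ht⟩ (⟨⟩ | ⟨⟨i, ⟨⟩ | ⟨b, ⟨⟩ | ⟨j, k⟩⟩⟩⟩ | k)
  exacts [hr, hh i, hc (i, b), hl ((i, b), j) k, ht k]

theorem sum_eq (f : WVert m t → ℕ) :
    ∑ v, f v = f root + ∑ i, f (hub i) + ∑ q, f (center q) + ∑ p, ∑ k, f (leg p k) +
      (f (tail 0) + f (tail 1)) := by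
  have hsum {α β : Type} [Fintype α] [Fintype β] (g : Unit ⊕ α × β → ℕ) :
      ∑ v, g v = g (Sum.inl ()) + ∑ a, ∑ b, g (Sum.inr (a, b)) := by
    simp [Fintype.sum_sum_type, Fintype.sum_prod_type]
  have hF (g : FVert t → ℕ) : ∑ v, g v = g (Sum.inl ()) + ∑ j, ∑ k, g (Sum.inr (j, k)) :=
    hsum g
  have hH (g : HVert t → ℕ) :
      ∑ v, g v = g (Sum.inl ()) + ∑ b, ∑ p, g (Sum.inr (b, p)) :=
    hsum g
  have hsum' {α β γ : Type} [Fintype α] [Fintype β] [Fintype γ]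
      (g : Unit ⊕ (α × β ⊕ γ) → ℕ) :
      ∑ v, g v = g (Sum.inl ()) +
        (∑ a, ∑ b, g (Sum.inr (Sum.inl (a, b))) + ∑ c, g (Sum.inr (Sum.inr c))) := by
    simp [Fintype.sum_sum_type, Fintype.sum_prod_type]
  have hW : ∑ v, f v = f (Sum.inl ()) + (∑ i, ∑ p, f (Sum.inr (Sum.inl (i, p))) +
      ∑ k, f (Sum.inr (Sum.inr k))) :=
    hsum' f
  rw [hW]
  simp only [hH, hF, Fintype.sum_prod_type, Finset.sum_add_distrib, Fin.sum_univ_two, root, hub,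
    center, leg, tail]
  ring

theorem adj_root_iff (v : WVert m t) :
    (Wtree m t).Adj v root ↔ (∃ i, v = hub i) ∨ v = tail 0 := by
  refine (Wtree_adj_iff _ _).trans ?_
  simp [root, hub, tail]
  exact Iff.rfl

theorem adj_tail_zero_iff (v : WVert m t) :
    (Wtree m t).Adj v (tail 0) ↔ v = root ∨ v = tail 1 := by
  refine (Wtree_adj_iff _ _).trans ?_
  simp only [root, tail]
  constructor
  · rintro (⟨-, _, h⟩ | ⟨h, -⟩ | ⟨h, -⟩ | ⟨h, -⟩ | ⟨_, _, _, -, -, h⟩ | ⟨-, h⟩ | ⟨-, h⟩)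
    all_goals first | cases h; done | skip
    exacts [Or.inl h, Or.inr h]
  · rintro (rfl | rfl) <;> simp

theorem adj_tail_one_iff (v : WVert m t) :
    (Wtree m t).Adj v (tail 1) ↔ v = tail 0 := by
  refine (Wtree_adj_iff _ _).trans ?_
  simp only [tail]
  constructor
  · rintro (⟨-, _, h⟩ | ⟨h, -⟩ | ⟨-, h⟩ | ⟨h, -⟩ | ⟨_, _, _, -, -, h⟩ | h | ⟨h, -⟩)
    all_goals first | cases h; done | skip
    exact h.1
  · rintro rfl
    simp

theorem adj_gadget_iff (v : WVert m t) (i : Fin m) (y : HVert t) :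
    (Wtree m t).Adj v (Sum.inr (Sum.inl (i, y))) ↔
      (v = root ∧ y = Sum.inl ()) ∨ ∃ x, (Htree t).Adj x y ∧ v = Sum.inr (Sum.inl (i, x)) := by
  refine (Wtree_adj_iff _ _).trans ?_
  constructor
  · rintro (⟨rfl, _, h⟩ | ⟨h, -⟩ | ⟨-, h⟩ | ⟨h, -⟩ | ⟨_, x, _, hx, rfl, h⟩ | ⟨-, h⟩ | ⟨h, -⟩)
    all_goals cases h
    exacts [Or.inl ⟨rfl, rfl⟩, Or.inr ⟨x, hx, rfl⟩]
  · rintro (⟨rfl, rfl⟩ | ⟨x, hx, rfl⟩)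
    exacts [Or.inl ⟨rfl, _, rfl⟩, Or.inr (Or.inr (Or.inr (Or.inr (Or.inl ⟨_, _, _, hx, rfl, rfl⟩))))]

theorem adj_hub_iff (v : WVert m t) (i : Fin m) :
    (Wtree m t).Adj v (hub i) ↔ v = root ∨ ∃ b, v = center (i, b) := by
  refine (adj_gadget_iff v i _).trans (or_congr (and_iff_left rfl) ⟨?_, ?_⟩)
  · rintro ⟨x, hx, rfl⟩
    have := (Htree_adj_iff _ _).1 hx
    simp at this
    obtain ⟨b, rfl⟩ := this
    exact ⟨b, rfl⟩
  · rintro ⟨b, rfl⟩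
    exact ⟨_, (Htree_adj_iff _ _).2 (Or.inr (Or.inl ⟨rfl, b, rfl⟩)), rfl⟩

theorem adj_branch_iff (v : WVert m t) (q : Fin m × Fin 3) (y : FVert t) :
    (Wtree m t).Adj v (Sum.inr (Sum.inl (q.1, Sum.inr (q.2, y)))) ↔
      (v = hub q.1 ∧ y = Sum.inl ()) ∨
        ∃ x, (Ftree t).Adj x y ∧ v = Sum.inr (Sum.inl (q.1, Sum.inr (q.2, x))) := by
  refine (adj_gadget_iff v q.1 _).trans ⟨?_, ?_⟩
  · rintro (⟨-, h⟩ | ⟨x, hx, rfl⟩)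
    · cases h
    · have := (Htree_adj_iff _ _).1 hx
      obtain ⟨rfl, _, h⟩ | ⟨h, -⟩ | ⟨_, x, _, hx, rfl, h⟩ := this <;> cases h
      exacts [Or.inl ⟨rfl, rfl⟩, Or.inr ⟨x, hx, rfl⟩]
  · rintro (⟨rfl, rfl⟩ | ⟨x, hx, rfl⟩)
    · exact Or.inr ⟨_, (Htree_adj_iff _ _).2 (Or.inl ⟨rfl, _, rfl⟩), rfl⟩
    · exact Or.inr ⟨_, (Htree_adj_iff _ _).2 (Or.inr (Or.inr ⟨_, _, _, hx, rfl, rfl⟩)), rfl⟩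

theorem adj_center_iff (v : WVert m t) (q : Fin m × Fin 3) :
    (Wtree m t).Adj v (center q) ↔ v = hub q.1 ∨ ∃ j, v = leg (q, j) 0 := by
  refine (adj_branch_iff v q _).trans (or_congr (and_iff_left rfl) ⟨?_, ?_⟩)
  · rintro ⟨x, hx, rfl⟩
    have := (Ftree_adj_iff _ _).1 hx
    simp at this
    obtain ⟨j, rfl⟩ := this
    exact ⟨j, rfl⟩
  · rintro ⟨j, rfl⟩
    exact ⟨_, (Ftree_adj_iff _ _).2 (Or.inr (Or.inl ⟨rfl, j, rfl⟩)), rfl⟩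

theorem adj_leg_iff (v : WVert m t) (p : (Fin m × Fin 3) × Fin t) (k : Fin 3) :
    (Wtree m t).Adj v (leg p k) ↔
      (v = center p.1 ∧ k = 0) ∨ ∃ a, (SimpleGraph.pathGraph 3).Adj a k ∧ v = leg p a := by
  refine (adj_branch_iff v p.1 _).trans ⟨?_, ?_⟩
  · rintro (⟨-, h⟩ | ⟨x, hx, rfl⟩)
    · cases h
    · have := (Ftree_adj_iff _ _).1 hx
      simp at this
      obtain ⟨rfl, rfl⟩ | ⟨a, ha, rfl⟩ := this
      exacts [Or.inl ⟨rfl, rfl⟩, Or.inr ⟨a, ha, rfl⟩]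
  · rintro (⟨rfl, rfl⟩ | ⟨a, ha, rfl⟩)
    · exact Or.inr ⟨_, (Ftree_adj_iff _ _).2 (Or.inl ⟨rfl, _, rfl⟩), rfl⟩
    · exact Or.inr ⟨_, (Ftree_adj_iff _ _).2 (Or.inr (Or.inr ⟨_, _, _, ha, rfl, rfl⟩)), rfl⟩

theorem domSet_iff (S : Finset (WVert m t)) :
    (Wtree m t).DomSet S ↔
      (root ∈ S ∨ tail 0 ∈ S ∨ ∃ i, hub i ∈ S) ∧
      (∀ i, hub i ∈ S ∨ root ∈ S ∨ ∃ b, center (i, b) ∈ S) ∧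
      (∀ q, center q ∈ S ∨ hub q.1 ∈ S ∨ ∃ j, leg (q, j) 0 ∈ S) ∧
      (∀ p, leg p 0 ∈ S ∨ leg p 1 ∈ S ∨ center p.1 ∈ S) ∧
      (∀ p, leg p 1 ∈ S ∨ leg p 2 ∈ S) ∧
      (tail 0 ∈ S ∨ tail 1 ∈ S) := by
  have hpath : ∀ a k : Fin 3, (SimpleGraph.pathGraph 3).Adj a k ↔
      a.val + 1 = k.val ∨ k.val + 1 = a.val := by
    simp [SimpleGraph.pathGraph_adj]
  have hleg (p : (Fin m × Fin 3) × Fin t) :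
      (∀ k, leg p k ∈ S ∨ ∃ u ∈ S, (Wtree m t).Adj u (leg p k)) ↔
        (leg p 0 ∈ S ∨ leg p 1 ∈ S ∨ center p.1 ∈ S) ∧ (leg p 1 ∈ S ∨ leg p 2 ∈ S) := by
    have h (k : Fin 3) : (∃ u ∈ S, (Wtree m t).Adj u (leg p k)) ↔
        (center p.1 ∈ S ∧ k = 0) ∨
          ∃ a : Fin 3, (a.val + 1 = k.val ∨ k.val + 1 = a.val) ∧ leg p a ∈ S := by
      simp only [adj_leg_iff, hpath]
      aesop
    simp [h, Fin.forall_fin_succ, Fin.exists_fin_succ]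
    tauto
  unfold SimpleGraph.DomSet
  rw [forall_iff]
  simp only [hleg, forall_and]
  simp only [adj_root_iff, adj_hub_iff, adj_center_iff, Fin.forall_fin_two,
    adj_tail_zero_iff, adj_tail_one_iff, and_or_left, exists_or, exists_eq_right]
  simp
  grind

open Classical in
/-- The trace of `S` on the copy of `L` indexed by `p`. -/
noncomputable def legs (S : Finset (WVert m t)) (p : (Fin m × Fin 3) × Fin t) :
    Finset (Fin 3) :=
  Finset.univ.filter fun k => leg p k ∈ S

theorem mem_legs {S : Finset (WVert m t)} {p : (Fin m × Fin 3) × Fin t} {k : Fin 3} :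
    k ∈ legs S p ↔ leg p k ∈ S := by
  simp [legs]

open Classical in
/-- The trace of `S` on the roots of the copies of `F_t`. -/
noncomputable def centers (S : Finset (WVert m t)) : Finset (Fin m × Fin 3) :=
  Finset.univ.filter fun q => center q ∈ S

open Classical in
theorem card_eq (S : Finset (WVert m t)) :
    S.card = (if root ∈ S then 1 else 0) + ∑ i, (if hub i ∈ S then 1 else 0) +
      (centers S).card + ∑ p, (legs S p).card +
      ((if tail 0 ∈ S then 1 else 0) + (if tail 1 ∈ S then 1 else 0)) := by
  have h := sum_eq fun v => if v ∈ S then 1 else 0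
  rw [Finset.sum_boole, Finset.filter_univ_mem] at h
  simpa [centers, legs] using h

theorem card_legs_pos {S : Finset (WVert m t)} (hS : (Wtree m t).DomSet S)
    (p : (Fin m × Fin 3) × Fin t) : 1 ≤ (legs S p).card := by
  rw [Nat.one_le_iff_ne_zero, Finset.card_ne_zero]
  rcases ((domSet_iff S).1 hS).2.2.2.2.1 p with h | h
  exacts [⟨1, mem_legs.2 h⟩, ⟨2, mem_legs.2 h⟩]

theorem le_sum_card_legs {S : Finset (WVert m t)} (hS : (Wtree m t).DomSet S)
    (q : Fin m × Fin 3) : t ≤ ∑ j, (legs S (q, j)).card := by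
  simpa using Finset.card_nsmul_le_sum Finset.univ (fun j => (legs S (q, j)).card) 1
    fun j _ => card_legs_pos hS (q, j)

theorem lt_sum_card_legs {S : Finset (WVert m t)} (hS : (Wtree m t).DomSet S)
    {q : Fin m × Fin 3} (hh : hub q.1 ∉ S) (hc : center q ∉ S) :
    t + 1 ≤ ∑ j, (legs S (q, j)).card := by
  obtain ⟨-, -, hC, -, hw, -⟩ := (domSet_iff S).1 hS
  obtain ⟨j, hj⟩ := ((hC q).resolve_left hc).resolve_left hh
  have h2 : 1 < (legs S (q, j)).card := by
    rw [Finset.one_lt_card]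
    rcases hw (q, j) with h | h
    exacts [⟨0, mem_legs.2 hj, 1, mem_legs.2 h, by decide⟩,
      ⟨0, mem_legs.2 hj, 2, mem_legs.2 h, by decide⟩]
  have := Finset.sum_lt_sum (s := Finset.univ) (f := fun _ : Fin t => 1)
    (g := fun j => (legs S (q, j)).card) (fun j _ => card_legs_pos hS (q, j))
    ⟨j, Finset.mem_univ _, h2⟩
  simpa using this

open Classical in
theorem gadget_bounds {S : Finset (WVert m t)} (hS : (Wtree m t).DomSet S) (i : Fin m) :
    3 * t + 1 + 2 * (if hub i ∈ S then 0 else 1) ≤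
        (if hub i ∈ S then 1 else 0) + ∑ b, (if center (i, b) ∈ S then 1 else 0) +
          ∑ b, ∑ j, (legs S ((i, b), j)).card ∧
      (∑ b, if center (i, b) ∈ S then 1 else 0) + (3 * t + 1) ≤
        (if hub i ∈ S then 1 else 0) + ∑ b, (if center (i, b) ∈ S then 1 else 0) +
          ∑ b, ∑ j, (legs S ((i, b), j)).card + (if hub i ∈ S then 0 else 1) := by
  have h1 (b : Fin 3) := le_sum_card_legs hS (i, b)
  have h2 (hh : hub i ∉ S) (b : Fin 3) : t + 1 ≤
      (if center (i, b) ∈ S then 1 else 0) + ∑ j, (legs S ((i, b), j)).card := by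
    split_ifs with hc
    · have := h1 b
      omega
    · simpa using lt_sum_card_legs hS (q := (i, b)) hh hc
  have h3 (b : Fin 3) : (if center (i, b) ∈ S then 1 else 0) ≤ 1 := by
    split_ifs <;> omega
  simp only [Fin.forall_fin_succ, Fin.forall_fin_zero, Fin.sum_univ_three] at *
  by_cases hh : hub i ∈ S
  · simp only [hh, if_true]
    simp at h1
    omega
  · specialize h2 hh
    simp only [hh, if_false]
    simp at h2 h3
    omega

theorem card_bounds {S : Finset (WVert m t)} (hS : (Wtree m t).DomSet S) {r : ℕ}
    (hr : S.card ≤ m * (3 * t + 1) + 1 + r) :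
    m * (3 * t + 1) + 1 ≤ S.card ∧ (centers S).card ≤ r + r / 2 := by
  classical
  have hcard := card_eq S
  have htail : 1 ≤ (if tail 0 ∈ S then 1 else 0) + (if tail 1 ∈ S then 1 else 0) := by
    rcases ((domSet_iff S).1 hS).2.2.2.2.2 with h | h <;> simp [h]
  have hA := Finset.sum_le_sum fun i (_ : i ∈ Finset.univ) => (gadget_bounds hS i).1
  have hB := Finset.sum_le_sum fun i (_ : i ∈ Finset.univ) => (gadget_bounds hS i).2
  have hC : (centers S).card = ∑ i, ∑ b, if center (i, b) ∈ S then 1 else 0 := by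
    rw [← Fintype.sum_prod_type', centers, Finset.card_filter]
  have hL : ∑ p, (legs S p).card = ∑ i, ∑ b, ∑ j, (legs S ((i, b), j)).card := by
    simp only [Fintype.sum_prod_type]
  simp only [Finset.sum_add_distrib, ← Finset.mul_sum, ← hC, ← hL, Finset.sum_const,
    Finset.card_univ, Fintype.card_fin, smul_eq_mul] at hA hB
  have : m * (3 * t + 1) = 3 * (m * t) + m := by ring
  omega

/-- The copies of `L` containing at least two vertices of `S`. -/
noncomputable def heavy (S : Finset (WVert m t)) : Finset ((Fin m × Fin 3) × Fin t) :=
  Finset.univ.filter fun p => 2 ≤ (legs S p).card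

theorem card_heavy_le {S : Finset (WVert m t)} (hS : (Wtree m t).DomSet S) {r : ℕ}
    (hr : S.card ≤ m * (3 * t + 1) + 1 + r) : (heavy S).card ≤ m + r := by
  classical
  have hcard := card_eq S
  have htail : 1 ≤ (if tail 0 ∈ S then 1 else 0) + (if tail 1 ∈ S then 1 else 0) := by
    rcases ((domSet_iff S).1 hS).2.2.2.2.2 with h | h <;> simp [h]
  have hle : ∑ p, (1 + if 2 ≤ (legs S p).card then 1 else 0) ≤ ∑ p, (legs S p).card := by
    refine Finset.sum_le_sum fun p _ => ?_
    have := card_legs_pos hS p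
    split_ifs <;> omega
  rw [Finset.sum_add_distrib, ← Finset.card_filter] at hle
  change _ + (heavy S).card ≤ _ at hle
  simp at hle
  have : m * (3 * t + 1) + m * 0 = m * 3 * t + m := by ring
  omega

/-- The part of `S` outside the copies of `L`. -/
noncomputable def core (S : Finset (WVert m t)) :
    Prop × Set (Fin m) × Finset (Fin m × Fin 3) × Set (Fin 2) :=
  (root ∈ S, {i | hub i ∈ S}, centers S, {k | tail k ∈ S})

theorem eq_of_core_eq_of_legs_eq {S T : Finset (WVert m t)} (hc : core S = core T)
    (hl : legs S = legs T) : S = T := by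
  simp only [core, Prod.mk.injEq, Set.ext_iff, Finset.ext_iff, Set.mem_ofPred_eq] at hc
  obtain ⟨h1, h2, h3, h4⟩ := hc
  rw [Finset.ext_iff, forall_iff]
  refine ⟨by rw [h1], h2, by simpa [centers] using h3, fun p k => ?_, h4⟩
  rw [← mem_legs, ← mem_legs, hl]

open Classical in
/-- The traces that a dominating set with prescribed `centers` and `heavy` contained in `B`
can have on the copy of `L` indexed by `p`. -/
noncomputable def traces (A : Finset (Fin m × Fin 3)) (B : Finset ((Fin m × Fin 3) × Fin t))
    (p : (Fin m × Fin 3) × Fin t) : Finset (Finset (Fin 3)) :=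
  if p ∈ B then Finset.univ else if p.1 ∈ A then {{1}, {2}} else {{1}}

theorem legs_mem_traces {S : Finset (WVert m t)} (hS : (Wtree m t).DomSet S)
    {B : Finset ((Fin m × Fin 3) × Fin t)} (hB : heavy S ⊆ B) (p : (Fin m × Fin 3) × Fin t) :
    legs S p ∈ traces (centers S) B p := by
  have h1 := card_legs_pos hS p
  obtain ⟨-, -, -, hu, hw, -⟩ := (domSet_iff S).1 hS
  have hu := hu p
  have hw := hw p
  have hc : center p.1 ∈ S ↔ p.1 ∈ centers S := by simp [centers]
  simp only [← mem_legs, hc] at hu hw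
  unfold traces
  split_ifs with hpB hpA
  · simp
  all_goals
    have h2 : (legs S p).card ≤ 1 := by
      by_contra! h
      exact hpB (hB (Finset.mem_filter.2 ⟨Finset.mem_univ _, h⟩))
    simp only [hpA, or_false] at hu
    generalize legs S p = s at *
    revert s
    decide

theorem card_piFinset_traces_le (A : Finset (Fin m × Fin 3))
    (B : Finset ((Fin m × Fin 3) × Fin t)) :
    (Fintype.piFinset (traces A B)).card ≤ 8 ^ B.card * 2 ^ (A.card * t) := by
  classical
  have h (p) : (traces A B p).card ≤
      (if p ∈ B then 8 else 1) * (if p.1 ∈ A then 2 else 1) := by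
    unfold traces
    split_ifs <;> decide
  rw [Fintype.card_piFinset]
  refine (Finset.prod_le_prod' fun p _ => h p).trans_eq ?_
  have hA : ∏ p : (Fin m × Fin 3) × Fin t, (if p.1 ∈ A then 2 else 1) = 2 ^ (A.card * t) := by
    rw [Fintype.prod_prod_type' fun q (_ : Fin t) => if q ∈ A then 2 else 1]
    simp [pow_mul, pow_right_comm]
  rw [Finset.prod_mul_distrib, hA]
  simp

theorem card_le (hm : 1 ≤ m) (r : ℕ) (ht : m + r ≤ t) (D : Finset (Finset (WVert m t)))
    (hD : ∀ S ∈ D, (Wtree m t).DomSet S ∧ S.card = m * (3 * t + 1) + 1 + r) :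
    D.card ≤ Nat.card (Prop × Set (Fin m) × Finset (Fin m × Fin 3) × Set (Fin 2)) *
      (m * 3 * t) ^ (m + r) * (8 ^ (m + r) * 2 ^ ((r + r / 2) * t)) := by
  classical
  have hcover : D ⊆ (Finset.univ ×ˢ Finset.univ.powersetCard (m + r)).biUnion
      fun x : (Prop × Set (Fin m) × Finset (Fin m × Fin 3) × Set (Fin 2)) ×
        Finset ((Fin m × Fin 3) × Fin t) => D.filter fun S => core S = x.1 ∧ heavy S ⊆ x.2 := by
    intro S hS
    obtain ⟨B, hB, -, hBc⟩ := Finset.exists_subsuperset_card_eq (Finset.subset_univ (heavy S))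
      (card_heavy_le (hD S hS).1 (hD S hS).2.le) (by simp; nlinarith)
    simp only [Finset.mem_biUnion, Finset.mem_product, Finset.mem_univ, true_and,
      Finset.mem_powersetCard, Finset.subset_univ, Finset.mem_filter]
    exact ⟨(core S, B), hBc, hS, rfl, hB⟩
  refine (Finset.card_le_card hcover).trans ((Finset.card_biUnion_le_card_mul _ _
    (8 ^ (m + r) * 2 ^ ((r + r / 2) * t)) ?_).trans (Nat.mul_le_mul_right _ ?_))
  · rintro ⟨P, B⟩ hPB
    obtain hE | ⟨S₀, hS₀⟩ := (D.filter fun S => core S = P ∧ heavy S ⊆ B).eq_empty_or_nonempty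
    · simp [hE]
    obtain ⟨hD₀, rfl, -⟩ := Finset.mem_filter.1 hS₀
    have hB : B.card = m + r := by simpa using hPB
    calc _ ≤ (Fintype.piFinset (traces (centers S₀) B)).card := by
          refine Finset.card_le_card_of_injOn legs (fun S hS => ?_) fun S hS T hT h => ?_
          · obtain ⟨hS, hc, hB⟩ := Finset.mem_filter.1 hS
            have hc : centers S = centers S₀ := congrArg (fun x => x.2.2.1) hc
            rw [Finset.mem_coe, Fintype.mem_piFinset, ← hc]
            exact legs_mem_traces (hD S hS).1 hB
          · exact eq_of_core_eq_of_legs_eq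
              ((Finset.mem_filter.1 hS).2.1.trans (Finset.mem_filter.1 hT).2.1.symm) h
      _ ≤ 8 ^ B.card * 2 ^ ((centers S₀).card * t) := card_piFinset_traces_le _ _
      _ ≤ _ := by
          rw [hB]
          gcongr
          · norm_num
          · exact (card_bounds (hD S₀ hD₀).1 (hD S₀ hD₀).2.le).2
  · rw [Finset.card_product, Finset.card_univ, ← Nat.card_eq_fintype_card,
      Finset.card_powersetCard]
    refine Nat.mul_le_mul_left _ ((Nat.choose_le_pow _ _).trans_eq ?_)
    simp

/-- Selected roots of copies of `F_t` in the construction of many dominating sets of size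
`γ(W_{m,t}) + r`: all those in the first `r / 2` copies of `H_t`, and one in the next copy
if `r` is odd. -/
def extremalCenters (m r : ℕ) : Finset (Fin m × Fin 3) :=
  Finset.univ.filter fun q => q.1.val < r / 2 ∨ (q.1.val = r / 2 ∧ r % 2 = 1 ∧ q.2 = 0)

/-- Membership predicate of the dominating set with `extremalCenters` that contains the leaf
of the copies of `L` indexed by `φ` and the middle vertex of the others. -/
def extremalMem (r : ℕ) (φ : Finset ((Fin m × Fin 3) × Fin t)) : WVert m t → Prop
  | Sum.inl () => False
  | Sum.inr (Sum.inl (i, Sum.inl ())) => r / 2 ≤ i.val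
  | Sum.inr (Sum.inl (i, Sum.inr (b, Sum.inl ()))) => (i, b) ∈ extremalCenters m r
  | Sum.inr (Sum.inl (i, Sum.inr (b, Sum.inr (j, k)))) =>
      k = if ((i, b), j) ∈ φ then 2 else 1
  | Sum.inr (Sum.inr k) => k = 0

open Classical in
/-- The dominating set described by `extremalMem`. -/
noncomputable def extremalSet (r : ℕ) (φ : Finset ((Fin m × Fin 3) × Fin t)) :
    Finset (WVert m t) :=
  Finset.univ.filter (extremalMem r φ)

section

variable (r : ℕ) (φ : Finset ((Fin m × Fin 3) × Fin t))

theorem mem_extremalSet (v : WVert m t) : v ∈ extremalSet r φ ↔ extremalMem r φ v := by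
  simp [extremalSet]

theorem root_notMem_extremalSet : root ∉ extremalSet r φ :=
  (mem_extremalSet r φ root).1

theorem hub_mem_extremalSet (i : Fin m) : hub i ∈ extremalSet r φ ↔ r / 2 ≤ i.val :=
  mem_extremalSet r φ _

theorem center_mem_extremalSet (q : Fin m × Fin 3) :
    center q ∈ extremalSet r φ ↔ q ∈ extremalCenters m r :=
  mem_extremalSet r φ _

theorem leg_mem_extremalSet (p : (Fin m × Fin 3) × Fin t) (k : Fin 3) :
    leg p k ∈ extremalSet r φ ↔ k = if p ∈ φ then 2 else 1 :=
  mem_extremalSet r φ _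

theorem tail_mem_extremalSet (k : Fin 2) : tail k ∈ extremalSet r φ ↔ k = 0 :=
  mem_extremalSet r φ _

end

theorem extremalSet_injective (r : ℕ) :
    Function.Injective (extremalSet r : Finset ((Fin m × Fin 3) × Fin t) → _) := by
  intro φ ψ h
  ext p
  have h2 := leg_mem_extremalSet r φ p 2
  rw [h, leg_mem_extremalSet] at h2
  split_ifs at h2 <;> simp_all

theorem domSet_extremalSet (r : ℕ) {φ : Finset ((Fin m × Fin 3) × Fin t)}
    (hφ : ∀ p ∈ φ, p.1 ∈ extremalCenters m r) : (Wtree m t).DomSet (extremalSet r φ) := by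
  rw [domSet_iff]
  simp only [root_notMem_extremalSet, hub_mem_extremalSet, center_mem_extremalSet,
    leg_mem_extremalSet, tail_mem_extremalSet]
  refine ⟨by simp, fun i => ?_, fun q => ?_, fun p => ?_, fun p => ?_, by simp⟩
  · rcases le_or_gt (r / 2) i with h | h
    · exact Or.inl h
    · exact Or.inr (Or.inr ⟨0, by simp [extremalCenters, h]⟩)
  · rcases le_or_gt (r / 2) q.1 with h | h
    · exact Or.inr (Or.inl h)
    · exact Or.inl (by simp [extremalCenters, h])
  · by_cases hp : p ∈ φ
    · exact Or.inr (Or.inr (hφ p hp))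
    · simp [hp]
  · by_cases hp : p ∈ φ <;> simp [hp]

theorem card_extremalCenters {r : ℕ} (hr : r ≤ 2 * m) :
    (extremalCenters m r).card = r + r / 2 := by
  have h (n : ℕ) : ∑ i ∈ Finset.range n, ((if i < r / 2 then 3 else 0) +
      if i = r / 2 ∧ r % 2 = 1 then 1 else 0) =
      3 * min n (r / 2) + if r / 2 < n then r % 2 else 0 := by
    induction n with
    | zero => simp
    | succ n ih =>
      rw [Finset.sum_range_succ, ih]
      split_ifs <;> omega
  have hb (i : Fin m) : (∑ b : Fin 3, if i.val < r / 2 ∨ (i.val = r / 2 ∧ r % 2 = 1 ∧ b = 0)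
      then 1 else 0) = (if i.val < r / 2 then 3 else 0) +
        if i.val = r / 2 ∧ r % 2 = 1 then 1 else 0 := by
    rw [Fin.sum_univ_three]
    by_cases h1 : i.val < r / 2
    · simp [h1, h1.ne]
    · by_cases h2 : i.val = r / 2 <;> by_cases h3 : r % 2 = 1 <;> simp [h1, h2, h3]
  rw [extremalCenters, Finset.card_filter, Fintype.sum_prod_type]
  simp only [hb]
  rw [Fin.sum_univ_eq_sum_range fun i => (if i < r / 2 then 3 else 0) +
    if i = r / 2 ∧ r % 2 = 1 then 1 else 0, h]
  split_ifs <;> omega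

theorem card_extremalSet {r : ℕ} (hr : r ≤ 2 * m) (φ : Finset ((Fin m × Fin 3) × Fin t)) :
    (extremalSet r φ).card = m * (3 * t + 1) + 1 + r := by
  classical
  have hc : centers (extremalSet r φ) = extremalCenters m r := by
    ext q
    simp [centers, center_mem_extremalSet]
  have hl (p) : (legs (extremalSet r φ) p).card = 1 := by
    rw [Finset.card_eq_one]
    exact ⟨if p ∈ φ then 2 else 1, by ext k; rw [mem_legs, leg_mem_extremalSet]; simp⟩
  have hh : ∑ i : Fin m, (if r / 2 ≤ i.val then 1 else 0) = m - r / 2 := by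
    have h (n : ℕ) :
        ∑ i ∈ Finset.range n, (if r / 2 ≤ i then 1 else 0) = n - r / 2 := by
      induction n with
      | zero => simp
      | succ n ih =>
        rw [Finset.sum_range_succ, ih]
        split_ifs <;> omega
    rw [Fin.sum_univ_eq_sum_range fun i => if r / 2 ≤ i then 1 else 0, h]
  rw [card_eq, hc, card_extremalCenters hr]
  simp only [hl, hub_mem_extremalSet, hh, root_notMem_extremalSet, tail_mem_extremalSet]
  simp
  have : m * (3 * t + 1) = m * 3 * t + m := by ring
  omega

theorem domNumber_Wtree (m t : ℕ) : domNumber (Wtree m t) = m * (3 * t + 1) + 1 := by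
  refine le_antisymm (Nat.sInf_le ⟨extremalSet 0 ∅, domSet_extremalSet 0 (by simp),
    card_extremalSet (by simp) ∅⟩) (le_csInf ⟨_, extremalSet 0 ∅,
      domSet_extremalSet 0 (by simp), rfl⟩ ?_)
  rintro _ ⟨S, hS, rfl⟩
  exact (card_bounds hS (r := S.card) (by omega)).1

end WVert

open Classical in
theorem eCoeff_eq_card (m t r : ℕ) : eCoeff m t r =
    (Finset.univ.filter fun S : Finset (WVert m t) =>
      (Wtree m t).DomSet S ∧ S.card = m * (3 * t + 1) + 1 + r).card := by
  rw [eCoeff, domCount, WVert.domNumber_Wtree]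
  exact Nat.subtype_card _ (by simp)

theorem eCoeff_le {m r t : ℕ} (hm : 1 ≤ m) (ht : m + r ≤ t) :
    eCoeff m t r ≤ Nat.card (Prop × Set (Fin m) × Finset (Fin m × Fin 3) × Set (Fin 2)) *
      (m * 3 * t) ^ (m + r) * (8 ^ (m + r) * 2 ^ ((r + r / 2) * t)) := by
  rw [eCoeff_eq_card]
  exact WVert.card_le hm r ht _ fun S hS => by simpa using hS

open WVert in
theorem le_eCoeff {m r : ℕ} (t : ℕ) (hr : r ≤ 2 * m) :
    2 ^ ((r + r / 2) * t) ≤ eCoeff m t r := by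
  classical
  rw [eCoeff_eq_card]
  have hcard : (extremalCenters m r ×ˢ (Finset.univ : Finset (Fin t))).powerset.card =
      2 ^ ((r + r / 2) * t) := by
    simp [card_extremalCenters hr]
  rw [← hcard]
  refine Finset.card_le_card_of_injOn (extremalSet r) (fun φ hφ => ?_)
    (extremalSet_injective r).injOn
  have hφ := Finset.mem_powerset.1 hφ
  refine Finset.mem_filter.2 ⟨Finset.mem_univ _,
    domSet_extremalSet r fun p hp => (Finset.mem_product.1 (hφ hp)).1, card_extremalSet hr φ⟩

/-- Fix `m ≥ 1` and `0 ≤ r ≤ 2m`, and set `v_r = r + ⌊r/2⌋`.  Then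
`e_r(m,t) = 2^{v_r t} t^{O(1)}`: there are `K ≥ 0`, `c, C > 0` and `t_0` with
`c ⬝ t^{-K} ⬝ 2^{v_r t} ≤ e_r(m,t) ≤ C ⬝ t^K ⬝ 2^{v_r t}` for all `t ≥ t_0`. -/
theorem eCoeff_growth (m r : ℕ) (hm : 1 ≤ m) (hr : r ≤ 2 * m) :
    ∃ (K : ℕ) (c C : ℝ), 0 < c ∧ 0 < C ∧ ∃ t0 : ℕ, ∀ t : ℕ, t0 ≤ t →
      c * 2 ^ ((r + r / 2) * t) / (t : ℝ) ^ K ≤ (eCoeff m t r : ℝ) ∧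
      (eCoeff m t r : ℝ) ≤ C * (t : ℝ) ^ K * 2 ^ ((r + r / 2) * t) := by
  set N := Nat.card (Prop × Set (Fin m) × Finset (Fin m × Fin 3) × Set (Fin 2))
  have hNpos : 0 < N := Nat.card_pos
  refine ⟨m + r, 1, N * (m * 3) ^ (m + r) * 8 ^ (m + r), one_pos, by positivity, m + r,
    fun t ht => ⟨?_, ?_⟩⟩
  · have ht1 : (1 : ℝ) ≤ (t : ℝ) ^ (m + r) := one_le_pow₀ (by exact_mod_cast (by omega))
    calc _ ≤ (1 : ℝ) * 2 ^ ((r + r / 2) * t) := div_le_self (by positivity) ht1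
      _ ≤ _ := by rw [one_mul]; exact_mod_cast le_eCoeff t hr
  · calc (eCoeff m t r : ℝ)
        ≤ (N * (m * 3 * t) ^ (m + r) * (8 ^ (m + r) * 2 ^ ((r + r / 2) * t)) : ℕ) :=
          Nat.cast_le.2 (eCoeff_le hm ht)
      _ = _ := by
          push_cast
          ring
end
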